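/- arXiv:1602.04895 — 2 statements merged into one kernel-verified Lean document; each statement's English description precedes it below -/
import Mathlib

section
/- Suppose reduced expressions i and i′ of w_0 are related by a single braid move, and fix a positive root β such that F_{i;β} = F_{i′;β}. Then for any n ≥ 0, the ℚ(q)-span of { F_i^a ∈ B_i : F_i^a ≠ F_β^{(n)} } equals the ℚ(q)-span of { F_{i′}^{a′} ∈ B_{i′} : F_{i′}^{a′} ≠ F_β^{(n)} }. -/
/-!
Common setup: the quantized universal enveloping algebra `U_q(𝔤)` of a simple
complex Lie algebra of type ADE, presented by the Chevalley generators
`E i`, `F i`, `K i`, `K i⁻¹` over `ℚ(q)`, together with the combinatorics of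
words in the Weyl group, PBW root vectors and monomials, Lusztig's braid group
automorphisms, the bar involution, lattices, and partial orders on Lusztig data.
-/

noncomputable section

open scoped BigOperators

/-- The base field `ℚ(q)`. -/
abbrev 𝕂 : Type := RatFunc ℚ

/-- The indeterminate `q ∈ ℚ(q)`. -/
noncomputable def qq : 𝕂 := RatFunc.X

/-- The Cartan matrix attached to an adjacency function: `2` on the diagonal,
`-1` for adjacent vertices, `0` otherwise. -/
def cartanOf {I : Type} [DecidableEq I] (adj : I → I → Bool) (i j : I) : ℤ :=
  if i = j then 2 else if adj i j then -1 else 0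

/-- The datum of a simply laced (ADE) Dynkin diagram of a simple Lie algebra:
a finite nonempty vertex set with a symmetric irreflexive adjacency relation,
connected (simple `𝔤`), whose Cartan matrix is positive definite (finite type;
together with simply-lacedness this characterizes types A, D, E). -/
structure ADEData (I : Type) [Fintype I] [DecidableEq I] : Type where
  nonE : Nonempty I
  adj : I → I → Bool
  symm : ∀ i j, adj i j = adj j i
  irrefl : ∀ i, adj i i = false
  conn : ∀ i j : I, Relation.ReflTransGen (fun a b => adj a b = true) i j
  posdef : ∀ v : I → ℚ, v ≠ 0 → 0 < ∑ i, ∑ j, (cartanOf adj i j : ℚ) * v i * v j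

variable {I : Type} [Fintype I] [DecidableEq I]

/-- Generators `E i`, `F i`, `K i`, `K i⁻¹` of `U_q(𝔤)`. -/
inductive Gen (I : Type) : Type
  | E : I → Gen I
  | F : I → Gen I
  | K : I → Gen I
  | Kinv : I → Gen I

/-- The free `ℚ(q)`-algebra on the generators. -/
abbrev FA (I : Type) := FreeAlgebra 𝕂 (Gen I)

def gE (i : I) : FA I := FreeAlgebra.ι 𝕂 (Gen.E i)
def gF (i : I) : FA I := FreeAlgebra.ι 𝕂 (Gen.F i)
def gK (i : I) : FA I := FreeAlgebra.ι 𝕂 (Gen.K i)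
def gKinv (i : I) : FA I := FreeAlgebra.ι 𝕂 (Gen.Kinv i)

/-- The defining relations of `U_q(𝔤)` (type ADE). -/
inductive QRel (D : ADEData I) : FA I → FA I → Prop
  | KKinv (i : I) : QRel D (gK i * gKinv i) 1
  | KinvK (i : I) : QRel D (gKinv i * gK i) 1
  | KcommK (i j : I) : QRel D (gK i * gK j) (gK j * gK i)
  | KEself (i : I) : QRel D (gK i * gE i * gKinv i) ((qq ^ 2) • gE i)
  | KFself (i : I) : QRel D (gK i * gF i * gKinv i) ((qq ^ 2)⁻¹ • gF i)
  | EFdiff (i j : I) (h : i ≠ j) : QRel D (gE i * gF j - gF j * gE i) 0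
  | EFself (i : I) :
      QRel D (gE i * gF i - gF i * gE i) ((qq - qq⁻¹)⁻¹ • (gK i - gKinv i))
  | serreE (i j : I) (h : D.adj i j = true) :
      QRel D (gE i ^ 2 * gE j + gE j * gE i ^ 2) ((qq + qq⁻¹) • (gE i * gE j * gE i))
  | serreF (i j : I) (h : D.adj i j = true) :
      QRel D (gF i ^ 2 * gF j + gF j * gF i ^ 2) ((qq + qq⁻¹) • (gF i * gF j * gF i))
  | KEadj (i j : I) (h : D.adj i j = true) :
      QRel D (gK i * gE j * gKinv i) (qq⁻¹ • gE j)
  | KFadj (i j : I) (h : D.adj i j = true) :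
      QRel D (gK i * gF j * gKinv i) (qq • gF j)
  | EEfar (i j : I) (h : i ≠ j) (h' : D.adj i j = false) :
      QRel D (gE i * gE j) (gE j * gE i)
  | FFfar (i j : I) (h : i ≠ j) (h' : D.adj i j = false) :
      QRel D (gF i * gF j) (gF j * gF i)
  | KEfar (i j : I) (h : i ≠ j) (h' : D.adj i j = false) :
      QRel D (gK i * gE j * gKinv i) (gE j)
  | KFfar (i j : I) (h : i ≠ j) (h' : D.adj i j = false) :
      QRel D (gK i * gF j * gKinv i) (gF j)

/-- The quantized universal enveloping algebra `U_q(𝔤)`. -/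
abbrev Uq (D : ADEData I) := RingQuot (QRel D)

/-- The generator `E i` of `U_q(𝔤)`. -/
def EE (D : ADEData I) (i : I) : Uq D := RingQuot.mkAlgHom 𝕂 (QRel D) (gE i)
/-- The generator `F i` of `U_q(𝔤)`. -/
def FF (D : ADEData I) (i : I) : Uq D := RingQuot.mkAlgHom 𝕂 (QRel D) (gF i)
/-- The generator `K i` of `U_q(𝔤)`. -/
def KK (D : ADEData I) (i : I) : Uq D := RingQuot.mkAlgHom 𝕂 (QRel D) (gK i)
/-- The generator `K i ⁻¹` of `U_q(𝔤)`. -/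
def KKinv (D : ADEData I) (i : I) : Uq D := RingQuot.mkAlgHom 𝕂 (QRel D) (gKinv i)

/-- The quantum integer `[n] = q^{n-1} + q^{n-3} + ⋯ + q^{-n+1}`. -/
def qInt (n : ℕ) : 𝕂 := ∑ t ∈ Finset.range n, qq ^ ((n : ℤ) - 1 - 2 * (t : ℤ))

/-- The quantum factorial `[n]! = [n][n-1]⋯[2][1]`. -/
def qFact (n : ℕ) : 𝕂 := ∏ t ∈ Finset.range n, qInt (t + 1)

/-- The `q`-divided power `X^{(n)} = X^n / [n]!`. -/
def dp {D : ADEData I} (x : Uq D) (n : ℕ) : Uq D := (qFact n)⁻¹ • x ^ n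

/-- `U_q^-(𝔤)`: the subalgebra generated by the `F i`. -/
def Uminus (D : ADEData I) : Subalgebra 𝕂 (Uq D) :=
  Algebra.adjoin 𝕂 (Set.range (FF D))

/-- `U_q^{≥0}(𝔤)`: the subalgebra generated by the `E i` and `K i^{±1}`. -/
def Ugeq0 (D : ADEData I) : Subalgebra 𝕂 (Uq D) :=
  Algebra.adjoin 𝕂 (Set.range (EE D) ∪ Set.range (KK D) ∪ Set.range (KKinv D))

/-- A family of algebra automorphisms `T i` is the family of Lusztig braid
automorphisms if it takes the prescribed values on all generators. -/
def IsLusztigAuts (D : ADEData I) (T : I → (Uq D ≃ₐ[𝕂] Uq D)) : Prop :=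
  ∀ i j : I,
    (T i (FF D i) = -(KKinv D i * EE D i)) ∧
    (D.adj i j = true → T i (FF D j) = FF D j * FF D i - qq • (FF D i * FF D j)) ∧
    (i ≠ j → D.adj i j = false → T i (FF D j) = FF D j) ∧
    (T i (EE D i) = -(FF D i * KK D i)) ∧
    (D.adj i j = true → T i (EE D j) = EE D i * EE D j - qq⁻¹ • (EE D j * EE D i)) ∧
    (i ≠ j → D.adj i j = false → T i (EE D j) = EE D j) ∧
    (T i (KK D i) = KKinv D i) ∧
    (D.adj i j = true → T i (KK D j) = KK D i * KK D j) ∧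
    (i ≠ j → D.adj i j = false → T i (KK D j) = KK D j)

/-- The Cartan matrix of the diagram. -/
def cartan (D : ADEData I) : I → I → ℤ := cartanOf D.adj

/-- The simple root `α i`, as a vector in the root lattice `ℤ^I`. -/
def simpleRoot (i : I) : I → ℤ := fun j => if j = i then 1 else 0

/-- The standard pairing `(v, α i)` on the root lattice. -/
def pairing (D : ADEData I) (v : I → ℤ) (i : I) : ℤ := ∑ j, v j * cartan D j i

/-- The simple reflection `s i` acting on the root lattice. -/
def sref (D : ADEData I) (i : I) (v : I → ℤ) : I → ℤ :=
  fun j => v j - pairing D v i * simpleRoot i j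

/-- Action of a word `(i₁, …, i_N)` on the root lattice: `s_{i₁} ∘ ⋯ ∘ s_{i_N}`. -/
def wordAct (D : ADEData I) : List I → (I → ℤ) → (I → ℤ)
  | [] => fun v => v
  | i :: l => fun v => sref D i (wordAct D l v)

/-- A word in the generators of the Weyl group is reduced if no shorter word
defines the same element (i.e., the same action on the root lattice). -/
def IsReducedWord (D : ADEData I) (w : List I) : Prop :=
  ∀ w' : List I, wordAct D w' = wordAct D w → w.length ≤ w'.length

/-- `w` is a reduced expression of the longest element `w₀` of the Weyl group. -/
def IsRedW0 (D : ADEData I) (w : List I) : Prop :=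
  IsReducedWord D w ∧ ∀ w' : List I, IsReducedWord D w' → w'.length ≤ w.length

/-- The root `β_k = s_{i₁} ⋯ s_{i_{k-1}} (α_{i_k})` attached to the `k`-th letter
of the word `w` (here `k` is 0-indexed). -/
def beta (D : ADEData I) (w : List I) (k : Fin w.length) : I → ℤ :=
  wordAct D (w.take k) (simpleRoot (w.get k))

/-- `v` is a root: it lies in the Weyl group orbit of a simple root. -/
def IsRoot (D : ADEData I) (v : I → ℤ) : Prop :=
  ∃ (l : List I) (i : I), v = wordAct D l (simpleRoot i)

/-- `v` is a positive root. -/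
def IsPosRoot (D : ADEData I) (v : I → ℤ) : Prop :=
  IsRoot D v ∧ ∀ j, 0 ≤ v j

/-- Apply `T_{i₁} ∘ T_{i₂} ∘ ⋯ ∘ T_{i_m}` for a word `(i₁, …, i_m)`. -/
def applyT {D : ADEData I} (T : I → (Uq D ≃ₐ[𝕂] Uq D)) : List I → Uq D → Uq D
  | [], x => x
  | i :: l, x => T i (applyT T l x)

/-- Apply `T_{i_m}^{-1} ∘ ⋯ ∘ T_{i₁}^{-1}` for a word `(i₁, …, i_m)`. -/
def applyTinv {D : ADEData I} (T : I → (Uq D ≃ₐ[𝕂] Uq D)) : List I → Uq D → Uq D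
  | [], x => x
  | i :: l, x => applyTinv T l ((T i).symm x)

/-- The PBW root vector `F_{i;β_k} = T_{i₁} ⋯ T_{i_{k-1}} (F_{i_k})`
(`k` is 0-indexed). -/
def rootVec {D : ADEData I} (T : I → (Uq D ≃ₐ[𝕂] Uq D)) (w : List I)
    (k : Fin w.length) : Uq D :=
  applyT T (w.take k) (FF D (w.get k))

/-- The PBW monomial `F^a = F_{β₁}^{(a₁)} F_{β₂}^{(a₂)} ⋯ F_{β_N}^{(a_N)}`
attached to the Lusztig datum `a`. -/
def pbw {D : ADEData I} (T : I → (Uq D ≃ₐ[𝕂] Uq D)) (w : List I)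
    (a : Fin w.length → ℕ) : Uq D :=
  ((List.finRange w.length).map (fun k => dp (rootVec T w k) (a k))).prod

/-- `u` is a homogeneous element of weight `μ` for the root-lattice grading of
`U_q(𝔤)`: conjugation by `K i` multiplies it by `q^{(μ, α_i)}`. -/
def HasWeight (D : ADEData I) (u : Uq D) (μ : I → ℤ) : Prop :=
  ∀ i, KK D i * u * KKinv D i = (qq ^ pairing D μ i) • u

/-- The weight `Σ_k a_k β_k` of a Lusztig datum. -/
def wtData (D : ADEData I) (w : List I) (a : Fin w.length → ℕ) : I → ℤ :=
  ∑ k, (a k : ℤ) • beta D w k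

/-- `a` is less than `b` in the left lexicographic order on Lusztig data:
at the first index where they differ, `a` is **bigger**. -/
def LtLeft {N : ℕ} (a b : Fin N → ℕ) : Prop :=
  ∃ k, b k < a k ∧ ∀ l, l < k → a l = b l

/-- `a` is less than `b` in the right lexicographic order on Lusztig data:
at the last index where they differ, `a` is **bigger**. -/
def LtRight {N : ℕ} (a b : Fin N → ℕ) : Prop :=
  ∃ k, b k < a k ∧ ∀ l, k < l → a l = b l

/-- The partial order `≺` on Lusztig data: same weight, and strictly smaller in
both lexicographic orders. -/
def Prec (D : ADEData I) (w : List I) (a b : Fin w.length → ℕ) : Prop :=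
  wtData D w a = wtData D w b ∧ LtLeft a b ∧ LtRight a b

/-- Two words are related by a single braid move. -/
def BraidMove (D : ADEData I) (w w' : List I) : Prop :=
  (∃ (w₁ w₂ : List I) (a b : I), a ≠ b ∧ D.adj a b = false ∧
      w = w₁ ++ a :: b :: w₂ ∧ w' = w₁ ++ b :: a :: w₂) ∨
  (∃ (w₁ w₂ : List I) (a b : I), D.adj a b = true ∧
      w = w₁ ++ a :: b :: a :: w₂ ∧ w' = w₁ ++ b :: a :: b :: w₂)

instance : Algebra (Polynomial ℤ) 𝕂 :=
  ((Polynomial.aeval qq : Polynomial ℤ →ₐ[ℤ] 𝕂)).toRingHom.toAlgebra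

instance (D : ADEData I) : Module (Polynomial ℤ) (Uq D) :=
  Module.compHom _ (algebraMap (Polynomial ℤ) 𝕂)

/-- The `ℤ[q]`-lattice `𝓛` spanned by the PBW monomials of `B_i`. -/
def latt {D : ADEData I} (T : I → (Uq D ≃ₐ[𝕂] Uq D)) (w : List I) :
    Submodule (Polynomial ℤ) (Uq D) :=
  Submodule.span (Polynomial ℤ) (Set.range (pbw T w))

/-- The sublattice `q𝓛`. -/
def qlatt {D : ADEData I} (T : I → (Uq D ≃ₐ[𝕂] Uq D)) (w : List I) :
    Submodule (Polynomial ℤ) (Uq D) :=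
  Submodule.span (Polynomial ℤ) ((fun x => qq • x) '' ((latt T w : Submodule (Polynomial ℤ) (Uq D)) : Set (Uq D)))

/-- `bar` is the bar involution: the `ℚ`-algebra involution fixing `E i` and
`F i`, sending `K i` to `K i⁻¹` and `q` to `q⁻¹`. -/
def IsBar (D : ADEData I) (bar : Uq D →+* Uq D) : Prop :=
  (∀ i, bar (EE D i) = EE D i) ∧ (∀ i, bar (FF D i) = FF D i) ∧
  (∀ i, bar (KK D i) = KKinv D i) ∧
  bar (algebraMap 𝕂 (Uq D) qq) = algebraMap 𝕂 (Uq D) qq⁻¹ ∧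
  ∀ x, bar (bar x) = x

/-- `c ∈ ℚ(q)` is a Laurent polynomial in `q`. -/
def IsLaurent (c : 𝕂) : Prop :=
  ∃ (f : Polynomial ℚ) (m : ℕ), c = qq⁻¹ ^ m * Polynomial.aeval qq f

/-- `b` is (an indexing of) the canonical basis: it lies in the lattice `𝓛`,
its residues mod `q𝓛` are the residues of the PBW monomials, and it is
bar-invariant. -/
def IsCanBasis {D : ADEData I} (T : I → (Uq D ≃ₐ[𝕂] Uq D)) (w : List I)
    (bar : Uq D →+* Uq D) (b : (Fin w.length → ℕ) → Uq D) : Prop :=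
  (∀ a, b a ∈ latt T w) ∧ (∀ a, b a - pbw T w a ∈ qlatt T w) ∧ (∀ a, bar (b a) = b a)

/-- The braid move from `w` to `w'` does not change the relative position of the
roots `u` and `v` in the enumerations of positive roots attached to `w`, `w'`. -/
def SameRelPos (D : ADEData I) (w w' : List I) (u v : I → ℤ) : Prop :=
  ∀ (k l : Fin w.length) (k' l' : Fin w'.length),
    beta D w k = u → beta D w l = v → beta D w' k' = u → beta D w' l' = v →
    ((k : ℕ) < (l : ℕ) ↔ (k' : ℕ) < (l' : ℕ))

/-- The subring `ℚ[q]₀ ⊆ ℚ(q)` of rational functions regular at `q = 0`. -/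
def Reg0 : Subring 𝕂 where
  carrier := {x | ∃ f g : Polynomial ℚ, Polynomial.eval 0 g ≠ 0 ∧
    x * algebraMap (Polynomial ℚ) 𝕂 g = algebraMap (Polynomial ℚ) 𝕂 f}
  zero_mem' := ⟨0, 1, by simp, by simp⟩
  one_mem' := ⟨1, 1, by simp, by simp⟩
  add_mem' := by
    rintro x y ⟨f1, g1, h1, e1⟩ ⟨f2, g2, h2, e2⟩
    refine ⟨f1 * g2 + f2 * g1, g1 * g2, by simpa using mul_ne_zero h1 h2, ?_⟩
    rw [map_mul, map_add, map_mul, map_mul, ← e1, ← e2]; ring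
  mul_mem' := by
    rintro x y ⟨f1, g1, h1, e1⟩ ⟨f2, g2, h2, e2⟩
    refine ⟨f1 * f2, g1 * g2, by simpa using mul_ne_zero h1 h2, ?_⟩
    rw [map_mul, map_mul, ← e1, ← e2]; ring
  neg_mem' := by
    rintro x ⟨f, g, h, e⟩
    exact ⟨-f, g, h, by rw [map_neg, ← e]; ring⟩

instance (D : ADEData I) : Module ↥Reg0 (Uq D) :=
  Module.compHom _ (Reg0.subtype)

/-- Iterated application of a family of operators along a word. -/
def applyOps {D : ADEData I} (Ft : I → Uq D → Uq D) : List I → Uq D → Uq D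
  | [], x => x
  | i :: l, x => Ft i (applyOps Ft l x)

/-- Kashiwara's lattice `𝓛(∞)`: the `ℚ[q]₀`-span of all elements obtained from
`1` by applying sequences of the Kashiwara operators. -/
def lattInf {D : ADEData I} (Ft : I → Uq D → Uq D) : Submodule ↥Reg0 (Uq D) :=
  Submodule.span ↥Reg0 {x : Uq D | ∃ l : List I, x = applyOps Ft l 1}

/-- The sublattice `q𝓛(∞)`. -/
def qlattInf {D : ADEData I} (Ft : I → Uq D → Uq D) : Submodule ↥Reg0 (Uq D) :=
  Submodule.span ↥Reg0 ((fun x => qq • x) '' ((lattInf Ft : Submodule ↥Reg0 (Uq D)) : Set (Uq D)))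

end
set_option linter.all false

namespace SpanProof

section generic
variable {K R : Type*} [Field K] [Ring R] [Algebra K R]

/-- `T_a T_b F_a = F_b`, generic. -/
theorem gen_TTF (q : K) (hq : q ≠ 0) (hd : q - q⁻¹ ≠ 0) (k l e f g : R) (hkl : k * l = 1) (hlk : l * k = 1)
    (hkf : k * f * l = (q ^ 2)⁻¹ • f) (hkg : k * g * l = q • g)
    (hef : e * f - f * e = (q - q⁻¹)⁻¹ • (k - l)) (heg : e * g = g * e) :
    (-(l * e)) * (g * f - q • (f * g)) - q • ((g * f - q • (f * g)) * (-(l * e))) = g := by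
  have hd2 : q ^ 2 - 1 ≠ 0 := by
    intro h; apply hd; field_simp; simpa using h
  have kg : k * g = q • (g * k) := by
    rw [← smul_mul_assoc, ← hkg]; simp [mul_assoc, hlk]
  have lg : l * g = q⁻¹ • (g * l) := by
    have : g * l = q • (l * g) := by
      rw [← mul_smul_comm, ← hkg]; simp [← mul_assoc, hlk]
    rw [this, smul_smul, inv_mul_cancel₀ hq, one_smul]
  have gl : g * l = q • (l * g) := by
    rw [lg, smul_smul, mul_inv_cancel₀ hq, one_smul]
  have fl : f * l = (q^2)⁻¹ • (l * f) := by
    rw [← mul_smul_comm, ← hkf]; simp [← mul_assoc, hlk]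
  have hC : (g * f - q • (f * g)) * l = q⁻¹ • (l * (g * f - q • (f * g))) := by
    have h1 : g * f * l = q⁻¹ • (l * (g * f)) := by
      rw [mul_assoc, fl, mul_smul_comm, ← mul_assoc, gl, smul_mul_assoc, smul_smul, mul_assoc]
      congr 1; field_simp
    have h2 : f * g * l = q⁻¹ • (l * (f * g)) := by
      rw [mul_assoc, gl, mul_smul_comm, ← mul_assoc, fl, smul_mul_assoc, smul_smul, mul_assoc]
      congr 1; field_simp
    simp only [sub_mul, mul_sub, smul_mul_assoc, mul_smul_comm, h1, h2]
    module
  have hE : e * (g * f - q • (f * g)) - (g * f - q • (f * g)) * e = -(q • (g * k)) := by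
    have hef' : e * f = f * e + (q - q⁻¹)⁻¹ • (k - l) := by rw [← hef]; abel
    have h1 : e * (g * f) = g * f * e + (q - q⁻¹)⁻¹ • (g * k - g * l) := by
      rw [← mul_assoc, heg, mul_assoc, hef', mul_add, mul_smul_comm, mul_sub, mul_assoc]
    have h2 : e * (f * g) = f * g * e + (q - q⁻¹)⁻¹ • (q • (g * k) - q⁻¹ • (g * l)) := by
      rw [← mul_assoc, hef', add_mul, smul_mul_assoc, sub_mul, kg, lg, mul_assoc, heg, mul_assoc]
    simp only [sub_mul, mul_sub, smul_mul_assoc, mul_smul_comm, h1, h2]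
    match_scalars <;> (try field_simp) <;> (try ring)
  have aux : ∀ C : R, C * l = q⁻¹ • (l * C) → (-(l * e)) * C - q • (C * (-(l * e))) = -(l * (e * C - C * e)) := by
    intro C hC
    rw [mul_neg, ← mul_assoc C, hC]
    rw [smul_neg, smul_mul_assoc, smul_smul, mul_inv_cancel₀ hq, one_smul, mul_sub, mul_assoc l, neg_mul, mul_assoc l]
    abel
  rw [aux _ hC, hE, mul_neg, neg_neg, mul_smul_comm, ← mul_assoc, lg, smul_mul_assoc, smul_smul, mul_inv_cancel₀ hq, one_smul,
    mul_assoc, hlk, mul_one]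

/-- `T_a T_b E_a = E_b`, generic. -/
theorem gen_TTE (q : K) (hq : q ≠ 0) (hd : q - q⁻¹ ≠ 0) (k l e f g : R) (hkl : k * l = 1) (hlk : l * k = 1)
    (hke : k * e * l = (q ^ 2) • e) (hkg : k * g * l = q⁻¹ • g)
    (hef : e * f - f * e = (q - q⁻¹)⁻¹ • (k - l)) (hgf : g * f = f * g) :
    (e * g - q⁻¹ • (g * e)) * (-(f * k)) - q⁻¹ • ((-(f * k)) * (e * g - q⁻¹ • (g * e))) = g := by
  have hd2 : q ^ 2 - 1 ≠ 0 := by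
    intro h; apply hd; field_simp; simpa using h
  have kg : k * g = q⁻¹ • (g * k) := by
    rw [← smul_mul_assoc, ← hkg]; simp [mul_assoc, hlk]
  have ke : k * e = (q^2) • (e * k) := by
    rw [← smul_mul_assoc, ← hke]; simp [mul_assoc, hlk]
  have lg : l * g = q • (g * l) := by
    have : g * l = q⁻¹ • (l * g) := by
      rw [← mul_smul_comm, ← hkg]; simp [← mul_assoc, hlk]
    rw [this, smul_smul, mul_inv_cancel₀ hq, one_smul]
  have hC : k * (e * g - q⁻¹ • (g * e)) = q • ((e * g - q⁻¹ • (g * e)) * k) := by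
    have h1 : k * (g * e) = q • (g * e * k) := by
      rw [← mul_assoc, kg, smul_mul_assoc, mul_assoc, ke, mul_smul_comm, smul_smul, ← mul_assoc]
      congr 1; field_simp
    have h2 : k * (e * g) = q • (e * g * k) := by
      rw [← mul_assoc, ke, smul_mul_assoc, mul_assoc, kg, mul_smul_comm, smul_smul, ← mul_assoc]
      congr 1; field_simp
    simp only [sub_mul, mul_sub, smul_mul_assoc, mul_smul_comm, h1, h2]
    module
  have hE : (e * g - q⁻¹ • (g * e)) * f - f * (e * g - q⁻¹ • (g * e)) = -(g * l) := by
    have hef' : e * f = f * e + (q - q⁻¹)⁻¹ • (k - l) := by rw [← hef]; abel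
    have h1 : g * e * f = f * (g * e) + (q - q⁻¹)⁻¹ • (g * k - g * l) := by
      rw [mul_assoc, hef', mul_add, mul_smul_comm, mul_sub, ← mul_assoc, hgf, mul_assoc]
    have h2 : e * g * f = f * (e * g) + (q - q⁻¹)⁻¹ • (q⁻¹ • (g * k) - q • (g * l)) := by
      rw [mul_assoc, hgf, ← mul_assoc, hef', add_mul, smul_mul_assoc, sub_mul, kg, lg, mul_assoc]
    simp only [sub_mul, mul_sub, smul_mul_assoc, mul_smul_comm, h1, h2]
    match_scalars <;> (try field_simp) <;> (try ring)
  have aux : ∀ C : R, k * C = q • (C * k) → C * (-(f * k)) - q⁻¹ • ((-(f * k)) * C) = -((C * f - f * C) * k) := by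
    intro C hC
    rw [neg_mul, mul_assoc f k, hC, mul_smul_comm, smul_neg, smul_smul, inv_mul_cancel₀ hq, one_smul, sub_mul, mul_neg,
      ← mul_assoc, ← mul_assoc]
    abel
  rw [aux _ hC, hE, neg_mul, neg_neg, mul_assoc, hlk, mul_one]

/-- The rank-two commutation lemma. -/
theorem serre_span (q : K) (hq : q ≠ 0) (A B : R)
    (hA : A ^ 2 * B + B * A ^ 2 = (q + q⁻¹) • (A * B * A))
    (hB : B ^ 2 * A + A * B ^ 2 = (q + q⁻¹) • (B * A * B)) (x y z : ℕ) :
    A ^ x * (B * A - q • (A * B)) ^ y * B ^ z ∈ Submodule.span K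
      {r : R | ∃ x' y' z' : ℕ, y' + z' = x + y ∧ x' + y' = y + z ∧
        r = B ^ x' * (A * B - q • (B * A)) ^ y' * A ^ z'} := by
  set C := A * B - q • (B * A) with hC
  let S : ℕ → ℕ → Submodule K R := fun m n => Submodule.span K
      {r : R | ∃ x' y' z' : ℕ, y' + z' = m ∧ x' + y' = n ∧ r = B ^ x' * C ^ y' * A ^ z'}
  have hAC : A * C = q⁻¹ • (C * A) := by
    have : A * C - q⁻¹ • (C * A) = A ^ 2 * B + B * A ^ 2 - (q + q⁻¹) • (A * B * A) := by
      simp only [hC, mul_sub, sub_mul, smul_mul_assoc, mul_smul_comm, pow_two, mul_assoc]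
      match_scalars <;> (try field_simp) <;> (try ring)
    rw [hA, sub_self] at this
    exact sub_eq_zero.mp this
  have hCB : C * B = q⁻¹ • (B * C) := by
    have : C * B - q⁻¹ • (B * C) = B ^ 2 * A + A * B ^ 2 - (q + q⁻¹) • (B * A * B) := by
      simp only [hC, mul_sub, sub_mul, smul_mul_assoc, mul_smul_comm, pow_two, mul_assoc]
      match_scalars <;> (try field_simp) <;> (try ring)
    rw [hB, sub_self] at this
    exact sub_eq_zero.mp this
  have hACy : ∀ y : ℕ, ∃ d : K, A * C ^ y = d • (C ^ y * A) := by
    intro y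
    induction y with
    | zero => exact ⟨1, by simp⟩
    | succ y ih =>
      obtain ⟨d, hd⟩ := ih
      refine ⟨d * q⁻¹, ?_⟩
      rw [pow_succ, ← mul_assoc, hd, smul_mul_assoc, mul_assoc, hAC, mul_smul_comm, smul_smul, mul_assoc]
  have hABx : ∀ x : ℕ, ∃ d : K, A * B ^ (x + 1) = q ^ (x + 1) • (B ^ (x + 1) * A) + d • (B ^ x * C) := by
    have hAB : A * B = C + q • (B * A) := by rw [hC]; abel
    intro x
    induction x with
    | zero => exact ⟨1, by simp [hAB, add_comm]⟩
    | succ x ih =>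
      obtain ⟨d, hd⟩ := ih
      refine ⟨q ^ (x + 1) + d * q⁻¹, ?_⟩
      rw [pow_succ B (x + 1), ← mul_assoc, hd, add_mul, smul_mul_assoc, smul_mul_assoc, mul_assoc, mul_assoc, hAB, hCB]
      simp only [mul_add, mul_smul_comm, ← mul_assoc, ← pow_succ]
      match_scalars <;> ring
  have one : (1 : R) ∈ S 0 0 := Submodule.subset_span ⟨0, 0, 0, rfl, rfl, by simp⟩
  have lB : ∀ m n (r : R), r ∈ S m n → B * r ∈ S m (n + 1) := by
    intro m n r hr
    induction hr using Submodule.span_induction with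
    | mem r h =>
      obtain ⟨x', y', z', h1, h2, rfl⟩ := h
      exact Submodule.subset_span ⟨x' + 1, y', z', h1, by omega, by rw [pow_succ' B]; simp only [mul_assoc]⟩
    | zero => simp
    | add a b _ _ ha hb => rw [mul_add]; exact add_mem ha hb
    | smul c a _ ha => rw [mul_smul_comm]; exact Submodule.smul_mem _ _ ha
  have lA : ∀ m n (r : R), r ∈ S m n → A * r ∈ S (m + 1) n := by
    intro m n r hr
    induction hr using Submodule.span_induction with
    | mem r h =>
      obtain ⟨x', y', z', h1, h2, rfl⟩ := h
      obtain ⟨d, hd⟩ := hACy y'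
      have key : B ^ x' * (A * C ^ y') * A ^ z' ∈ S (m + 1) n := by
        rw [hd, mul_smul_comm, smul_mul_assoc]
        refine Submodule.smul_mem _ _ (Submodule.subset_span ⟨x', y', z' + 1, by omega, h2, ?_⟩)
        rw [pow_succ' A]; simp only [mul_assoc]
      rcases x' with _ | x'
      · simpa [mul_assoc] using key
      · obtain ⟨d', hd'⟩ := hABx x'
        rw [← mul_assoc, ← mul_assoc, hd', add_mul, add_mul]
        refine add_mem ?_ ?_
        · simp only [smul_mul_assoc]
          refine Submodule.smul_mem _ _ ?_
          simpa only [mul_assoc] using key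
        · simp only [smul_mul_assoc]
          refine Submodule.smul_mem _ _ (Submodule.subset_span ⟨x', y' + 1, z', by omega, by omega, ?_⟩)
          rw [pow_succ' C]; simp only [mul_assoc]
    | zero => simp
    | add a b _ _ ha hb => rw [mul_add]; exact add_mem ha hb
    | smul c a _ ha => rw [mul_smul_comm]; exact Submodule.smul_mem _ _ ha
  have hBz : ∀ z, B ^ z ∈ S 0 z := by
    intro z
    induction z with
    | zero => simpa using one
    | succ z ih => rw [pow_succ']; exact lB _ _ _ ih
  have hCy : ∀ y, (B * A - q • (A * B)) ^ y * B ^ z ∈ S y (y + z) := by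
    intro y
    induction y with
    | zero => simpa using hBz z
    | succ y ih =>
      rw [pow_succ', mul_assoc, sub_mul, smul_mul_assoc, mul_assoc, mul_assoc]
      have e : y + 1 + z = y + z + 1 := by omega
      rw [e]
      exact sub_mem (lB _ _ _ (lA _ _ _ ih)) (Submodule.smul_mem _ _ (lA _ _ _ (lB _ _ _ ih)))
  have hAx : ∀ x, A ^ x * ((B * A - q • (A * B)) ^ y * B ^ z) ∈ S (x + y) (y + z) := by
    intro x
    induction x with
    | zero => simpa using hCy y
    | succ x ih =>
      rw [pow_succ', mul_assoc]
      have e : x + 1 + y = x + y + 1 := by omega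
      rw [e]
      exact lA _ _ _ ih
  rw [mul_assoc]
  exact hAx x

/-- If `f` and `g` commute then `g = 0`. -/
theorem degenerate (q : K) (hq : q ≠ 0) (h1 : q - 1 ≠ 0) (h1' : q + 1 ≠ 0) (h2 : q ^ 2 + 1 ≠ 0) (h3 : q ^ 3 + 1 ≠ 0)
    (k l e f k' l' e' g : R) (hkl : k * l = 1) (hlk : l * k = 1) (hkl' : k' * l' = 1) (hlk' : l' * k' = 1)
    (hkf : k * f * l = (q ^ 2)⁻¹ • f) (hkg : k * g * l = q • g)
    (hkf' : k' * f * l' = q • f) (hkg' : k' * g * l' = (q ^ 2)⁻¹ • g)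
    (hef : e * f - f * e = (q - q⁻¹)⁻¹ • (k - l)) (heg : e * g = g * e)
    (heg' : e' * g - g * e' = (q - q⁻¹)⁻¹ • (k' - l')) (hef' : e' * f = f * e')
    (hfg : f * g = g * f) : g = 0 := by
  have hd : q - q⁻¹ ≠ 0 := by
    intro h
    apply mul_ne_zero h1 h1'
    field_simp at h
    linear_combination h
  -- conjugation forms
  have move : ∀ (k l u : R) (c : K), k * l = 1 → l * k = 1 → c ≠ 0 → k * u * l = c • u →
      k * u = c • (u * k) ∧ l * u = c⁻¹ • (u * l) := by
    intro k l u c hkl hlk hc h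
    refine ⟨by rw [← smul_mul_assoc, ← h]; simp [mul_assoc, hlk], ?_⟩
    have : u * l = c • (l * u) := by
      rw [← mul_smul_comm, ← h]; simp [← mul_assoc, hlk]
    rw [this, smul_smul, inv_mul_cancel₀ hc, one_smul]
  have q2 : (q ^ 2)⁻¹ ≠ 0 := inv_ne_zero (pow_ne_zero _ hq)
  -- first consequence
  have step1 : ∀ (k l e f g : R), k * l = 1 → l * k = 1 → k * g * l = q • g →
      e * f - f * e = (q - q⁻¹)⁻¹ • (k - l) → e * g = g * e → f * g = g * f →
      g * (k * k) = (-q⁻¹) • g := by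
    intro k l e f g hkl hlk hkg hef heg hfg
    obtain ⟨m1, m2⟩ := move k l g q hkl hlk hq hkg
    have hh : (k - l) * g = g * (k - l) := by
      have a1 : (e * f - f * e) * g = g * (e * f - f * e) := by
        rw [sub_mul, mul_sub]
        have b1 : e * f * g = g * (e * f) := by rw [mul_assoc, hfg, ← mul_assoc, heg, mul_assoc]
        have b2 : f * e * g = g * (f * e) := by rw [mul_assoc, heg, ← mul_assoc, hfg, mul_assoc]
        rw [b1, b2]
      rw [hef, smul_mul_assoc, mul_smul_comm] at a1
      exact smul_right_injective R (inv_ne_zero hd) a1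
    rw [sub_mul, mul_sub, m1, m2] at hh
    have hh2 := congrArg (· * k) hh
    simp only [sub_mul, smul_mul_assoc, mul_assoc, hlk, mul_one] at hh2
    have : (q - 1) • (g * (k * k)) = (q - 1) • ((-q⁻¹) • g) := by
      have e1 : (q - 1) • (g * (k * k)) = (q • (g * (k * k)) - q⁻¹ • g) - g * (k * k) + q⁻¹ • g := by module
      rw [e1, hh2]
      match_scalars <;> (try field_simp) <;> (try ring)
    exact smul_right_injective R h1 this
  have A1 : g * (k * k) = (-q⁻¹) • g := step1 k l e f g hkl hlk hkg hef heg hfg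
  have A1' : f * (k' * k') = (-q⁻¹) • f := step1 k' l' e' g f hkl' hlk' hkf' heg' hef' hfg.symm
  have mkk : ∀ (k u : R) (c : K), k * u = c • (u * k) → k * k * u = (c ^ 2) • (u * (k * k)) := by
    intro k u c h
    rw [mul_assoc, h, mul_smul_comm, ← mul_assoc, h, smul_mul_assoc, smul_smul, mul_assoc, pow_two]
  -- squares vanish
  have step2 : ∀ (k l g : R), k * l = 1 → l * k = 1 → k * g * l = q • g → g * (k * k) = (-q⁻¹) • g → g * g = 0 := by
    intro k l g hkl hlk hkg h
    obtain ⟨m1, m2⟩ := move k l g q hkl hlk hq hkg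
    have a := mkk k g q m1
    rw [h, smul_smul] at a
    have b : g * (k * k) * g = g * (k * k * g) := mul_assoc _ _ _
    rw [h, a, smul_mul_assoc, mul_smul_comm] at b
    have c : (q - q⁻¹) • (g * g) = 0 := by
      have : (q - q⁻¹) • (g * g) = (-q⁻¹) • (g * g) - (q ^ 2 * -q⁻¹) • (g * g) := by
        match_scalars <;> (try field_simp) <;> (try ring)
      rw [this, b, sub_self]
    exact (smul_eq_zero.mp c).resolve_left hd
  have B1 := step2 k l g hkl hlk hkg A1
  have B1' := step2 k' l' f hkl' hlk' hkf' A1'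
  -- f k^2 = q^2 f
  have A2 : f * (k * k) = (q ^ 2) • f := by
    obtain ⟨m1, m2⟩ := move k l f _ hkl hlk q2 hkf
    have hh : (k - l) * f + f * (k - l) = 0 := by
      have : (e * f - f * e) * f + f * (e * f - f * e) = e * (f * f) - (f * f) * e := by noncomm_ring
      rw [hef, B1', mul_zero, zero_mul, sub_zero, smul_mul_assoc, mul_smul_comm, ← smul_add] at this
      exact (smul_eq_zero.mp this).resolve_left (inv_ne_zero hd)
    rw [sub_mul, mul_sub, m1, m2] at hh
    have hh2 := congrArg (· * k) hh
    simp only [sub_mul, add_mul, smul_mul_assoc, mul_assoc, hlk, mul_one, zero_mul] at hh2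
    have : (q ^ 2 + 1) • (f * (k * k) - (q ^ 2) • f) = (q ^ 2) • (((q ^ 2)⁻¹ • (f * (k * k)) - ((q ^ 2)⁻¹)⁻¹ • f) + (f * (k * k) - f)) := by
      match_scalars <;> (try field_simp) <;> (try ring)
    rw [hh2, smul_zero] at this
    exact sub_eq_zero.mp ((smul_eq_zero.mp this).resolve_left h2)
  have Z : f * g = 0 := by
    have a : f * g * (k * k) = (-q⁻¹) • (f * g) := by rw [mul_assoc, A1, mul_smul_comm]
    have b : f * g * (k * k) = (q ^ 2) • (f * g) := by rw [hfg, mul_assoc, A2, mul_smul_comm]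
    have c : (q ^ 3 + 1) • (f * g) = 0 := by
      have : (q ^ 3 + 1) • (f * g) = q • ((q ^ 2) • (f * g) - (-q⁻¹) • (f * g)) := by
        match_scalars <;> (try field_simp) <;> (try ring)
      rw [this, ← a, ← b, sub_self, smul_zero]
    exact (smul_eq_zero.mp c).resolve_left h3
  obtain ⟨m1, m2⟩ := move k l g q hkl hlk hq hkg
  have hh : (k - l) * g = 0 := by
    have : (e * f - f * e) * g = e * (f * g) - f * g * e := by
      rw [sub_mul, mul_assoc, mul_assoc, heg, mul_assoc]
    rw [hef, Z, mul_zero, zero_mul, sub_zero, smul_mul_assoc] at this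
    exact (smul_eq_zero.mp this).resolve_left (inv_ne_zero hd)
  have hh2 : k * k * g = g := by
    have : k * ((k - l) * g) = k * k * g - g := by rw [← mul_assoc, mul_sub, sub_mul, hkl, one_mul]
    rw [hh, mul_zero] at this
    exact (sub_eq_zero.mp this.symm)
  rw [mkk k g q m1, A1, smul_smul] at hh2
  have : (q + 1) • g = 0 := by
    have : (q + 1) • g = g - (q ^ 2 * -q⁻¹) • g := by
      match_scalars <;> (try field_simp) <;> (try ring)
    rw [this, hh2, sub_self]
  exact (smul_eq_zero.mp this).resolve_left h1'

theorem degenerate_propagate (q : K) (hd : q - q⁻¹ ≠ 0)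
    (k l e f g : R) (hkl : k * l = 1)
    (hkg : k * g * l = q • g) (hef : e * f - f * e = (q - q⁻¹)⁻¹ • (k - l)) (hf : f = 0) : g = 0 := by
  subst hf
  simp only [mul_zero, zero_mul, sub_zero] at hef
  have h := (smul_eq_zero.mp hef.symm).resolve_left (inv_ne_zero hd)
  have hkl2 : k = l := sub_eq_zero.mp h
  subst hkl2
  have h1 : k * (k * g * k) * k = g := by
    have : k * (k * g * k) * k = (k * k) * g * (k * k) := by noncomm_ring
    rw [this, hkl]; simp
  rw [hkg, mul_smul_comm, smul_mul_assoc, hkg, smul_smul] at h1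
  have hq : q ≠ 0 := by rintro rfl; simp at hd
  have h2 : (q - q⁻¹) • g = 0 := by
    have : (q - q⁻¹) • g = q⁻¹ • ((q * q) • g - g) := by
      match_scalars <;> (try field_simp) <;> (try ring)
    rw [this, h1, sub_self, smul_zero]
  exact (smul_eq_zero.mp h2).resolve_left hd

end generic

theorem gen_farF {K R : Type*} [Field K] [Ring R] [Algebra K R] (q : K) (A B C : R) (h : A * B = B * A) :
    (C * A - q • (A * C)) * B - q • (B * (C * A - q • (A * C))) = (C * B - q • (B * C)) * A - q • (A * (C * B - q • (B * C))) := by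
  have e2 : ∀ z, A * (B * z) = B * (A * z) := by
    intro z; rw [← mul_assoc, h, mul_assoc]
  simp only [mul_sub, sub_mul, smul_mul_assoc, mul_smul_comm, mul_assoc, h, e2]
  module

theorem gen_farE {K R : Type*} [Field K] [Ring R] [Algebra K R] (q : K) (A B C : R) (h : A * B = B * A) :
    B * (A * C - q • (C * A)) - q • ((A * C - q • (C * A)) * B) = A * (B * C - q • (C * B)) - q • ((B * C - q • (C * B)) * A) := by
  have e2 : ∀ z, A * (B * z) = B * (A * z) := by
    intro z; rw [← mul_assoc, h, mul_assoc]
  simp only [mul_sub, sub_mul, smul_mul_assoc, mul_smul_comm, mul_assoc, h, e2]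
  module

theorem gen_brF {K R : Type*} [Field K] [Ring R] [Algebra K R] (q : K) (A B C : R) (h : A * C = C * A) :
    C * (B * A - q • (A * B)) - q • ((B * A - q • (A * B)) * C) = (C * B - q • (B * C)) * A - q • (A * (C * B - q • (B * C))) := by
  have e2 : ∀ z, A * (C * z) = C * (A * z) := by
    intro z; rw [← mul_assoc, h, mul_assoc]
  simp only [mul_sub, sub_mul, smul_mul_assoc, mul_smul_comm, mul_assoc, h, e2]
  module

theorem gen_brE {K R : Type*} [Field K] [Ring R] [Algebra K R] (q : K) (A B C : R) (h : A * C = C * A) :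
    (A * B - q • (B * A)) * C - q • (C * (A * B - q • (B * A))) = A * (B * C - q • (C * B)) - q • ((B * C - q • (C * B)) * A) := by
  have e2 : ∀ z, A * (C * z) = C * (A * z) := by
    intro z; rw [← mul_assoc, h, mul_assoc]
  simp only [mul_sub, sub_mul, smul_mul_assoc, mul_smul_comm, mul_assoc, h, e2]
  module


section uq
variable {I : Type} [Fintype I] [DecidableEq I] {D : ADEData I}

theorem qq_poly (p : Polynomial ℚ) (hp : p ≠ 0) : algebraMap (Polynomial ℚ) 𝕂 p ≠ 0 :=
  (map_ne_zero_iff _ (RatFunc.algebraMap_injective ℚ)).mpr hp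

theorem qq_X : algebraMap (Polynomial ℚ) 𝕂 Polynomial.X = qq := RatFunc.algebraMap_X

theorem qq_poly1 (p : Polynomial ℚ) (hp : p.eval 1 ≠ 0) : algebraMap (Polynomial ℚ) 𝕂 p ≠ 0 := by
  apply qq_poly; rintro rfl; simp at hp
theorem qq_poly2 (p : Polynomial ℚ) (hp : p.eval 2 ≠ 0) : algebraMap (Polynomial ℚ) 𝕂 p ≠ 0 := by
  apply qq_poly; rintro rfl; simp at hp

theorem qq_ne : qq ≠ 0 := by
  have := qq_poly1 Polynomial.X (by simp)
  rwa [qq_X] at this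
theorem qq_ne1 : qq - 1 ≠ 0 := by
  have := qq_poly2 (Polynomial.X - 1) (by norm_num)
  rwa [map_sub, map_one, qq_X] at this
theorem qq_ne2 : qq + 1 ≠ 0 := by
  have := qq_poly2 (Polynomial.X + 1) (by norm_num)
  rwa [map_add, map_one, qq_X] at this
theorem qq_ne3 : qq ^ 2 + 1 ≠ 0 := by
  have := qq_poly2 (Polynomial.X ^ 2 + 1) (by norm_num)
  rwa [map_add, map_pow, map_one, qq_X] at this
theorem qq_ne4 : qq ^ 3 + 1 ≠ 0 := by
  have := qq_poly2 (Polynomial.X ^ 3 + 1) (by norm_num)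
  rwa [map_add, map_pow, map_one, qq_X] at this
theorem qq_d : qq - qq⁻¹ ≠ 0 := by
  intro h
  have h0 := qq_ne
  apply mul_ne_zero qq_ne1 qq_ne2
  field_simp at h
  linear_combination h

theorem qInt_ne (n : ℕ) : qInt (n + 1) ≠ 0 := by
  have h := qq_poly1 (∑ t ∈ Finset.range (n + 1), Polynomial.X ^ (2 * (n - t)))
    (by rw [Polynomial.eval_finsetSum]; simp; positivity)
  intro h0
  apply h
  have : algebraMap (Polynomial ℚ) 𝕂 (∑ t ∈ Finset.range (n + 1), (Polynomial.X : Polynomial ℚ) ^ (2 * (n - t)))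
      = qq ^ n * qInt (n + 1) := by
    rw [map_sum, qInt, Finset.mul_sum]
    refine Finset.sum_congr rfl fun t ht => ?_
    have ht' : t ≤ n := by simpa [Nat.lt_succ_iff] using ht
    rw [map_pow, qq_X, ← zpow_natCast, ← zpow_natCast, ← zpow_add₀ qq_ne]
    congr 1
    push_cast [Nat.cast_sub ht']
    ring
  rw [this, h0, mul_zero]

theorem qFact_ne (n : ℕ) : qFact n ≠ 0 := Finset.prod_ne_zero_iff.mpr fun t _ => qInt_ne t

theorem rel {x y : FA I} (h : QRel D x y) : RingQuot.mkAlgHom 𝕂 (QRel D) x = RingQuot.mkAlgHom 𝕂 (QRel D) y :=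
  RingQuot.mkAlgHom_rel 𝕂 h

theorem rKL (i : I) : KK D i * KKinv D i = 1 := by simpa [KK, KKinv, EE, FF] using rel (QRel.KKinv (D := D) i)
theorem rLK (i : I) : KKinv D i * KK D i = 1 := by simpa [KK, KKinv, EE, FF] using rel (QRel.KinvK (D := D) i)
theorem rKK (i j : I) : KK D i * KK D j = KK D j * KK D i := by simpa [KK, KKinv, EE, FF] using rel (QRel.KcommK (D := D) i j)
theorem rKE (i : I) : KK D i * EE D i * KKinv D i = (qq ^ 2) • EE D i := by
  simpa [KK, KKinv, EE, FF] using rel (QRel.KEself (D := D) i)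
theorem rKF (i : I) : KK D i * FF D i * KKinv D i = (qq ^ 2)⁻¹ • FF D i := by
  have := rel (QRel.KFself (D := D) i)
  rw [map_smul] at this
  simpa [KK, KKinv, EE, FF] using this
theorem rEF (i j : I) (h : i ≠ j) : EE D i * FF D j = FF D j * EE D i := by
  have := rel (QRel.EFdiff (D := D) i j h)
  rw [map_sub, map_zero] at this
  simpa [KK, KKinv, EE, FF, sub_eq_zero] using this
theorem rEFs (i : I) : EE D i * FF D i - FF D i * EE D i = (qq - qq⁻¹)⁻¹ • (KK D i - KKinv D i) := by
  have := rel (QRel.EFself (D := D) i)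
  rw [map_smul] at this
  simpa [KK, KKinv, EE, FF] using this
theorem rSF (i j : I) (h : D.adj i j = true) :
    FF D i ^ 2 * FF D j + FF D j * FF D i ^ 2 = (qq + qq⁻¹) • (FF D i * FF D j * FF D i) := by
  have := rel (QRel.serreF (D := D) i j h)
  rw [map_smul] at this
  simpa [KK, KKinv, EE, FF] using this
theorem rKEa (i j : I) (h : D.adj i j = true) : KK D i * EE D j * KKinv D i = qq⁻¹ • EE D j := by
  have := rel (QRel.KEadj (D := D) i j h)
  rw [map_smul] at this
  simpa [KK, KKinv, EE, FF] using this
theorem rKFa (i j : I) (h : D.adj i j = true) : KK D i * FF D j * KKinv D i = qq • FF D j := by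
  have := rel (QRel.KFadj (D := D) i j h)
  rw [map_smul] at this
  simpa [KK, KKinv, EE, FF] using this
theorem rEE (i j : I) (h : i ≠ j) (h' : D.adj i j = false) : EE D i * EE D j = EE D j * EE D i := by
  simpa [KK, KKinv, EE, FF] using rel (QRel.EEfar (D := D) i j h h')
theorem rFF (i j : I) (h : i ≠ j) (h' : D.adj i j = false) : FF D i * FF D j = FF D j * FF D i := by
  simpa [KK, KKinv, EE, FF] using rel (QRel.FFfar (D := D) i j h h')

theorem adj_ne {i j : I} (h : D.adj i j = true) : i ≠ j := by
  rintro rfl; rw [D.irrefl] at h; cases h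

theorem Uq_ext (f g : Uq D →ₐ[𝕂] Uq D) (hF : ∀ i, f (FF D i) = g (FF D i)) (hE : ∀ i, f (EE D i) = g (EE D i))
    (hK : ∀ i, f (KK D i) = g (KK D i)) : f = g := by
  apply RingQuot.ringQuot_ext'
  apply FreeAlgebra.hom_ext
  funext x
  cases x with
  | E i => exact hE i
  | F i => exact hF i
  | K i => exact hK i
  | Kinv i =>
    change f (KKinv D i) = g (KKinv D i)
    have h1 : f (KKinv D i) * f (KK D i) = 1 := by rw [← map_mul, rLK, map_one]
    have h2 : f (KK D i) * g (KKinv D i) = 1 := by rw [hK, ← map_mul, rKL, map_one]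
    exact left_inv_eq_right_inv h1 h2

theorem no_triangle {a b c : I} (h1 : D.adj a b = true) (h2 : D.adj a c = true) (h3 : D.adj b c = true) : False := by
  have nab := adj_ne h1
  have nac := adj_ne h2
  have nbc := adj_ne h3
  have h1' : D.adj b a = true := by rw [D.symm]; exact h1
  have h2' : D.adj c a = true := by rw [D.symm]; exact h2
  have h3' : D.adj c b = true := by rw [D.symm]; exact h3
  have h := D.posdef (fun i => if i ∈ ({a, b, c} : Finset I) then 1 else 0) (fun h => by simpa using congrFun h a)
  simp only [mul_ite, mul_one, mul_zero, Finset.sum_ite_mem, Finset.univ_inter] at h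
  rw [Finset.sum_comm] at h
  simp only [Finset.sum_ite_mem, Finset.univ_inter] at h
  have e : ∀ f : I → ℚ, ∑ x ∈ ({a, b, c} : Finset I), f x = f a + (f b + f c) := by
    intro f
    rw [Finset.sum_insert (by simp [nab, nac]), Finset.sum_insert (by simp [nbc]), Finset.sum_singleton]
  simp only [e] at h
  simp [cartanOf, h1, h2, h3, h1', h2', h3', nab, nac, nbc, nab.symm, nac.symm, nbc.symm] at h
  norm_num at h

variable {T : I → (Uq D ≃ₐ[𝕂] Uq D)}

theorem linv_of {x y z : Uq D} (h1 : x * y = 1) (h2 : y * z = 1) : x = z := left_inv_eq_right_inv h1 h2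

theorem T_Kinv (i j : I) (u v : Uq D) (h : T i (KK D j) = u) (hv : u * v = 1) : T i (KKinv D j) = v := by
  refine linv_of (y := u) ?_ hv
  rw [← h, ← map_mul, rLK, map_one]

section
variable (hT : IsLusztigAuts D T)
include hT

theorem tF (i : I) : T i (FF D i) = -(KKinv D i * EE D i) := (hT i i).1
theorem tFa {i j : I} (h : D.adj i j = true) : T i (FF D j) = FF D j * FF D i - qq • (FF D i * FF D j) := (hT i j).2.1 h
theorem tFn {i j : I} (h : i ≠ j) (h' : D.adj i j = false) : T i (FF D j) = FF D j := (hT i j).2.2.1 h h'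
theorem tE (i : I) : T i (EE D i) = -(FF D i * KK D i) := (hT i i).2.2.2.1
theorem tEa {i j : I} (h : D.adj i j = true) : T i (EE D j) = EE D i * EE D j - qq⁻¹ • (EE D j * EE D i) := (hT i j).2.2.2.2.1 h
theorem tEn {i j : I} (h : i ≠ j) (h' : D.adj i j = false) : T i (EE D j) = EE D j := (hT i j).2.2.2.2.2.1 h h'
theorem tK (i : I) : T i (KK D i) = KKinv D i := (hT i i).2.2.2.2.2.2.1
theorem tKa {i j : I} (h : D.adj i j = true) : T i (KK D j) = KK D i * KK D j := (hT i j).2.2.2.2.2.2.2.1 h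
theorem tKn {i j : I} (h : i ≠ j) (h' : D.adj i j = false) : T i (KK D j) = KK D j := (hT i j).2.2.2.2.2.2.2.2 h h'
theorem tL (i : I) : T i (KKinv D i) = KK D i := T_Kinv i i _ _ (tK hT i) (rLK i)
theorem tLn {i j : I} (h : i ≠ j) (h' : D.adj i j = false) : T i (KKinv D j) = KKinv D j :=
  T_Kinv i j _ _ (tKn hT h h') (rKL j)

theorem TTF {a b : I} (h : D.adj a b = true) : T a (T b (FF D a)) = FF D b := by
  have h' : D.adj b a = true := by rw [D.symm]; exact h
  rw [tFa hT h', map_sub, map_smul, map_mul, map_mul, tF hT, tFa hT h]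
  exact gen_TTF qq qq_ne qq_d (KK D a) (KKinv D a) (EE D a) (FF D a) (FF D b) (rKL a) (rLK a) (rKF a) (rKFa a b h)
    (rEFs a) (rEF a b (adj_ne h))

theorem TTE {a b : I} (h : D.adj a b = true) : T a (T b (EE D a)) = EE D b := by
  have h' : D.adj b a = true := by rw [D.symm]; exact h
  rw [tEa hT h', map_sub, map_smul, map_mul, map_mul, tE hT, tEa hT h]
  exact gen_TTE qq qq_ne qq_d (KK D a) (KKinv D a) (EE D a) (FF D a) (EE D b) (rKL a) (rLK a) (rKE a) (rKEa a b h)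
    (rEFs a) (rEF b a (adj_ne h'))

theorem TTK {a b : I} (h : D.adj a b = true) : T a (T b (KK D a)) = KK D b := by
  have h' : D.adj b a = true := by rw [D.symm]; exact h
  rw [tKa hT h', map_mul, tKa hT h, tK hT, rKK a b, mul_assoc, rKL, mul_one]

theorem TTL {a b : I} (h : D.adj a b = true) : T a (T b (KKinv D a)) = KKinv D b := by
  refine linv_of (y := KK D b) ?_ (rKL b)
  rw [← TTK hT h, ← map_mul, ← map_mul, rLK, map_one, map_one]

theorem far_comm {a b : I} (hab : a ≠ b) (h : D.adj a b = false) (x : Uq D) : T a (T b x) = T b (T a x) := by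
  have hba : D.adj b a = false := by rw [D.symm]; exact h
  have key : ((T a).toAlgHom.comp (T b).toAlgHom) = ((T b).toAlgHom.comp (T a).toAlgHom) := by
    apply Uq_ext
    all_goals
      intro c
      change T a (T b _) = T b (T a _)
      by_cases hca : c = a
      · subst hca
        simp only [tFn hT hab.symm hba, tEn hT hab.symm hba, tKn hT hab.symm hba, tF hT, tE hT, tK hT, map_neg, map_mul,
          tLn hT hab.symm hba]
      by_cases hcb : c = b
      · subst hcb
        simp only [tFn hT hab h, tEn hT hab h, tKn hT hab h, tF hT, tE hT, tK hT, map_neg, map_mul,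
          tLn hT hab h]
      have nca : a ≠ c := fun e => hca e.symm
      have ncb : b ≠ c := fun e => hcb e.symm
      cases h1 : D.adj a c <;> cases h2 : D.adj b c <;>
      simp only [tFn hT nca, tFn hT ncb, tEn hT nca, tEn hT ncb, tKn hT nca, tKn hT ncb, h1, h2,
        tFa hT (i := a) (j := c), tFa hT (i := b) (j := c), tEa hT (i := a) (j := c), tEa hT (i := b) (j := c), tKa hT (i := a) (j := c), tKa hT (i := b) (j := c), tFn hT hab h, tEn hT hab h, tKn hT hab h,
        tFn hT hab.symm hba, tEn hT hab.symm hba, tKn hT hab.symm hba, map_mul, map_sub, map_smul]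
    · exact gen_farF qq _ _ _ (rFF a b hab h)
    · exact gen_farE qq⁻¹ _ _ _ (rEE a b hab h)
    · rw [← mul_assoc, ← mul_assoc, rKK a b]
  exact DFunLike.congr_fun key x


theorem braid {a b : I} (h : D.adj a b = true) (x : Uq D) : T a (T b (T a x)) = T b (T a (T b x)) := by
  have h' : D.adj b a = true := by rw [D.symm]; exact h
  have key : ((T a).toAlgHom.comp ((T b).toAlgHom.comp (T a).toAlgHom)) =
      ((T b).toAlgHom.comp ((T a).toAlgHom.comp (T b).toAlgHom)) := by
    apply Uq_ext
    all_goals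
      intro c
      change T a (T b (T a _)) = T b (T a (T b _))
      by_cases hca : c = a
      · subst hca
        simp only [TTF hT h, TTE hT h, TTK hT h, TTL hT h, tF hT, tE hT, tK hT, map_neg, map_mul]
      by_cases hcb : c = b
      · subst hcb
        simp only [TTF hT h', TTE hT h', TTK hT h', TTL hT h', tF hT, tE hT, tK hT, map_neg, map_mul]
      have nca : a ≠ c := fun e => hca e.symm
      have ncb : b ≠ c := fun e => hcb e.symm
      cases h1 : D.adj a c <;> cases h2 : D.adj b c <;> first | exact (no_triangle h h1 h2).elim | skip
      all_goals
        simp only [tFn hT nca, tFn hT ncb, tEn hT nca, tEn hT ncb, tKn hT nca, tKn hT ncb, h1, h2,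
          tFa hT (i := a) (j := c), tFa hT (i := b) (j := c), tEa hT (i := a) (j := c), tEa hT (i := b) (j := c), tKa hT (i := a) (j := c), tKa hT (i := b) (j := c), 
          TTF hT h, TTF hT h', TTE hT h, TTE hT h', TTK hT h, TTK hT h',
          map_mul, map_sub, map_smul]
        try simp only [tFa hT h, tFa hT h', tEa hT h, tEa hT h', tKa hT h, tKa hT h']
    · exact gen_brF qq _ _ _ (rFF a c nca h1)
    · exact (gen_brF qq _ _ _ (rFF b c ncb h2)).symm
    · exact gen_brE qq⁻¹ _ _ _ (rEE a c nca h1)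
    · exact (gen_brE qq⁻¹ _ _ _ (rEE b c ncb h2)).symm
    · simp only [← mul_assoc, rKK a b]
    · simp only [← mul_assoc, rKK a b]
  exact DFunLike.congr_fun key x
end

theorem all_F_zero {a b : I} (h : D.adj a b = true) (hc : FF D a * FF D b = FF D b * FF D a) (i : I) : FF D i = 0 := by
  have h' : D.adj b a = true := by rw [D.symm]; exact h
  have hb : FF D b = 0 := degenerate qq qq_ne qq_ne1 qq_ne2 qq_ne3 qq_ne4
    (KK D a) (KKinv D a) (EE D a) (FF D a) (KK D b) (KKinv D b) (EE D b) (FF D b) (rKL a) (rLK a) (rKL b) (rLK b)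
    (rKF a) (rKFa a b h) (rKFa b a h') (rKF b) (rEFs a) (rEF a b (adj_ne h)) (rEFs b) (rEF b a (adj_ne h')) hc
  have := D.conn b i
  induction this with
  | refl => exact hb
  | tail _ hxy ih =>
    exact degenerate_propagate qq qq_d _ _ _ _ _ (rKL _) (rKFa _ _ hxy) (rEFs _) ih
end uq

section roots
variable {I : Type} [Fintype I] [DecidableEq I] (D : ADEData I)

theorem cartan_symm (i j : I) : cartan D i j = cartan D j i := by
  unfold cartan cartanOf
  by_cases h : i = j
  · simp [h]
  · simp [h, Ne.symm h, D.symm i j]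

theorem cartan_self (i : I) : cartan D i i = 2 := by simp [cartan, cartanOf]
theorem cartan_adj {i j : I} (h : D.adj i j = true) : cartan D i j = -1 := by
  simp [cartan, cartanOf, h, adj_ne h]
theorem cartan_far {i j : I} (hn : i ≠ j) (h : D.adj i j = false) : cartan D i j = 0 := by
  simp [cartan, cartanOf, h, hn]

theorem pairing_simple (i j : I) : pairing D (simpleRoot i) j = cartan D i j := by
  simp [pairing, simpleRoot]

theorem pairing_sref (i j : I) (v : I → ℤ) :
    pairing D (sref D i v) j = pairing D v j - pairing D v i * cartan D i j := by
  conv_lhs => unfold pairing sref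
  simp only [sub_mul, Finset.sum_sub_distrib]
  congr 1
  simp [simpleRoot]

theorem sref_eq (i : I) (v : I → ℤ) : sref D i v = v - pairing D v i • simpleRoot i := by
  funext j; simp [sref]

theorem sref_sref (i : I) (v : I → ℤ) : sref D i (sref D i v) = v := by
  funext j
  rw [sref, pairing_sref, cartan_self, sref]; ring

theorem sref_far {a b : I} (hn : a ≠ b) (h : D.adj a b = false) (v : I → ℤ) :
    sref D a (sref D b v) = sref D b (sref D a v) := by
  have h1 := cartan_far D hn h
  have h2 := cartan_symm D a b
  funext j
  simp only [sref, pairing_sref D, ← sref_eq]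
  rw [← h2, h1]; ring

theorem sref_braid {a b : I} (h : D.adj a b = true) (v : I → ℤ) :
    sref D a (sref D b (sref D a v)) = sref D b (sref D a (sref D b v)) := by
  have h1 := cartan_adj D h
  have h2 : cartan D b a = -1 := by rw [cartan_symm]; exact h1
  funext j
  simp only [sref, pairing_sref D, cartan_self, h1, h2]
  ring

theorem sref_simple (i j : I) : sref D i (simpleRoot j) = simpleRoot j - cartan D j i • simpleRoot i := by
  rw [sref_eq, pairing_simple]

theorem root_braid {a b : I} (h : D.adj a b = true) : sref D a (sref D b (simpleRoot a)) = simpleRoot b := by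
  have h1 := cartan_adj D h
  have h2 : cartan D b a = -1 := by rw [cartan_symm]; exact h1
  rw [sref_eq D a, pairing_sref, sref_simple, pairing_simple, cartan_self, pairing_simple, h1, h2]
  module

theorem root_mid {a b : I} (h : D.adj a b = true) : sref D a (simpleRoot b) = sref D b (simpleRoot a) := by
  have h1 := cartan_adj D h
  have h2 : cartan D b a = -1 := by rw [cartan_symm]; exact h1
  rw [sref_simple, sref_simple, h1, h2]
  module

theorem root_far {a b : I} (hn : a ≠ b) (h : D.adj a b = false) : sref D a (simpleRoot b) = simpleRoot b := by
  rw [sref_simple, cartan_symm, cartan_far D hn h]; simp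

/-- symmetric form -/
def bil (u v : I → ℤ) : ℤ := ∑ j, v j * pairing D u j

theorem bil_simple (u : I → ℤ) (i : I) : bil D u (simpleRoot i) = pairing D u i := by
  simp [bil, simpleRoot]

theorem bil_neg (u v : I → ℤ) : bil D u (-v) = - bil D u v := by
  simp [bil]

theorem pairing_sum (v : I → ℤ) (i : I) : pairing D v i = ∑ j, v j * cartan D i j := by
  unfold pairing; exact Finset.sum_congr rfl fun j _ => by rw [cartan_symm]

theorem bil_sref (i : I) (u v : I → ℤ) : bil D (sref D i u) (sref D i v) = bil D u v := by
  unfold bil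
  have : ∀ j, sref D i v j * pairing D (sref D i u) j =
      v j * pairing D u j - pairing D u i * (v j * cartan D i j) - pairing D v i * (simpleRoot i j * pairing D u j)
      + pairing D v i * pairing D u i * (simpleRoot i j * cartan D i j) := by
    intro j; rw [pairing_sref, sref]; ring
  simp only [this, Finset.sum_add_distrib, Finset.sum_sub_distrib, ← Finset.mul_sum]
  rw [← pairing_sum D v i]
  have e1 : ∑ j, simpleRoot i j * pairing D u j = pairing D u i := by simp [simpleRoot]
  have e2 : ∑ j, simpleRoot i j * cartan D i j = 2 := by simp [simpleRoot, cartan_self]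
  rw [e1, e2]; ring

theorem wordAct_append (l m : List I) (v : I → ℤ) : wordAct D (l ++ m) v = wordAct D l (wordAct D m v) := by
  induction l with
  | nil => rfl
  | cons i l ih => simp only [List.cons_append, wordAct, ih]

theorem bil_word (l : List I) (u v : I → ℤ) : bil D (wordAct D l u) (wordAct D l v) = bil D u v := by
  induction l with
  | nil => rfl
  | cons i l ih => simp only [wordAct, bil_sref, ih]

theorem sref_lin (i : I) (u v : I → ℤ) (c : ℤ) : sref D i (u - c • v) = sref D i u - c • sref D i v := by
  have : pairing D (u - c • v) i = pairing D u i - c * pairing D v i := by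
    simp [pairing, sub_mul, Finset.sum_sub_distrib, Finset.mul_sum, mul_assoc]
  rw [sref_eq, sref_eq, sref_eq, this]
  module

theorem word_lin (l : List I) (u v : I → ℤ) (c : ℤ) :
    wordAct D l (u - c • v) = wordAct D l u - c • wordAct D l v := by
  induction l with
  | nil => rfl
  | cons i l ih => simp only [wordAct, ih, sref_lin]

theorem sref_inj (i : I) {u v : I → ℤ} (h : sref D i u = sref D i v) : u = v := by
  rw [← sref_sref D i u, h, sref_sref]

theorem word_inj (l : List I) {u v : I → ℤ} (h : wordAct D l u = wordAct D l v) : u = v := by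
  induction l with
  | nil => exact h
  | cons i l ih => exact ih (sref_inj D i h)

/-- the deletion argument -/
theorem not_reduced (p m r : List I) (i j : I)
    (h : wordAct D (p ++ i :: m) (simpleRoot j) = wordAct D p (simpleRoot i)) :
    ¬ IsReducedWord D (p ++ i :: m ++ j :: r) := by
  intro hred
  rw [wordAct_append] at h
  have h1 := word_inj D p h
  have h2 : wordAct D m (simpleRoot j) = - simpleRoot i := by
    apply sref_inj D i
    rw [show sref D i (wordAct D m (simpleRoot j)) = simpleRoot i from h1]
    have := sref_lin D i 0 (simpleRoot i) 1
    have z : sref D i 0 = 0 := by funext j; simp [sref, pairing]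
    rw [z, sref_simple, cartan_self] at this
    rw [show -simpleRoot i = (0 : I → ℤ) - (1:ℤ) • simpleRoot i by simp, this]
    module
  have key : ∀ v, sref D i (wordAct D m (sref D j v)) = wordAct D m v := by
    intro v
    have e : pairing D v j = - pairing D (wordAct D m v) i := by
      rw [← bil_simple, ← bil_word D m, h2, bil_neg, bil_simple]
    rw [sref_eq D j, word_lin, h2, e, ← sref_sref D i (wordAct D m v)]
    congr 1
    rw [sref_sref, sref_eq D i]; module
  have := hred (p ++ m ++ r) (by
    funext v
    simp only [wordAct_append, wordAct, List.append_assoc, List.cons_append]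
    rw [key])
  simp at this

theorem beta_lt (w : List I) (hw : IsReducedWord D w) (k l : Fin w.length) (h : (k : ℕ) < l) :
    beta D w k ≠ beta D w l := by
  intro e
  have d1 : w = w.take l ++ w.get l :: w.drop (l + 1) := by
    simp
  have d2 : w.take l = w.take k ++ w.get k :: (w.take l).drop (k + 1) := by
    conv_lhs => rw [← List.take_append_drop k (w.take l)]
    rw [List.take_take, min_eq_left h.le, List.drop_eq_getElem_cons (by simp; omega)]
    simp
  refine not_reduced D (w.take k) ((w.take l).drop (k + 1)) (w.drop (l + 1)) (w.get k) (w.get l) ?_ ?_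
  · rw [← d2]; exact e.symm
  · rw [← d2, ← d1]; exact hw

theorem beta_inj (w : List I) (hw : IsReducedWord D w) (k l : Fin w.length) (h : beta D w k = beta D w l) : k = l := by
  rcases lt_trichotomy (k : ℕ) l with h1 | h1 | h1
  · exact (beta_lt D w hw k l h1 h).elim
  · exact Fin.ext h1
  · exact (beta_lt D w hw l k h1 h.symm).elim

/-- beta at a split -/
theorem beta_split (p r : List I) (i : I) (k : Fin (p ++ i :: r).length) (hk : (k : ℕ) = p.length) :
    beta D (p ++ i :: r) k = wordAct D p (simpleRoot i) := by
  unfold beta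
  have : (p ++ i :: r).get k = i := by simp [hk]
  rw [this, hk]; simp

theorem beta_eq {p r p' r' : List I} {i i' : I} {w w' : List I} (hw : w = p ++ i :: r) (hw' : w' = p' ++ i' :: r')
    (k : Fin w.length) (k' : Fin w'.length) (hk : (k : ℕ) = p.length) (hk' : (k' : ℕ) = p'.length)
    (h : wordAct D p (simpleRoot i) = wordAct D p' (simpleRoot i')) : beta D w k = beta D w' k' := by
  subst hw hw'
  rw [beta_split D p r i k hk, beta_split D p' r' i' k' hk', h]

omit [Fintype I] [DecidableEq I] in
theorem split_at (l : List I) (t : ℕ) (ht : t < l.length) : ∃ p i r, l = p ++ i :: r ∧ p.length = t :=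
  ⟨l.take t, l[t], l.drop (t + 1), by simp, by simp; omega⟩

theorem pos_far {w1 w2 : List I} {a b : I} (hn : a ≠ b) (h : D.adj a b = false)
    {w w' : List I} (hw : w = w1 ++ a :: b :: w2) (hw' : w' = w1 ++ b :: a :: w2) (hr : IsReducedWord D w')
    (k : Fin w.length) (k' : Fin w'.length) (hb : beta D w k = beta D w' k') :
    (k' : ℕ) = if (k : ℕ) = w1.length then w1.length + 1 else if (k : ℕ) = w1.length + 1 then w1.length else k := by
  have hba : D.adj b a = false := by rw [D.symm]; exact h
  have hl : w.length = w1.length + 2 + w2.length := by simp [hw]; omega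
  have hl' : w'.length = w1.length + 2 + w2.length := by simp [hw']; omega
  have hk := k.2
  have fin : ∀ t : Fin w'.length, beta D w k = beta D w' t → (k' : ℕ) = t := by
    intro t ht
    rw [beta_inj D w' hr k' t (hb.symm.trans ht)]
  split_ifs with c1 c2
  · refine fin ⟨w1.length + 1, by omega⟩ (beta_eq D (p := w1) (p' := w1 ++ [b]) (i := a) (i' := a) (r := b :: w2) (r' := w2)
      hw (by simp [hw']) k _ c1 (by simp) ?_)
    rw [wordAct_append]; simp only [wordAct]; rw [root_far D hn.symm hba]
  · refine fin ⟨w1.length, by omega⟩ (beta_eq D (p := w1 ++ [a]) (p' := w1) (i := b) (i' := b) (r := w2) (r' := a :: w2)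
      (by simp [hw]) hw' k _ (by simp [c2]) (by simp) ?_)
    rw [wordAct_append]; simp only [wordAct]; rw [root_far D hn h]
  · refine fin ⟨k, by omega⟩ ?_
    rcases lt_or_ge (k : ℕ) w1.length with c | c
    · obtain ⟨p, i, r, hd, hp⟩ := split_at w1 k c
      exact beta_eq D (p := p) (p' := p) (i := i) (i' := i) (r := r ++ a :: b :: w2)
        (r' := r ++ b :: a :: w2) (by simp [hw, hd]) (by simp [hw', hd]) k _ hp.symm hp.symm rfl
    · obtain ⟨t, ht⟩ : ∃ t, (k : ℕ) = w1.length + 2 + t := ⟨k - (w1.length + 2), by omega⟩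
      have htl : t < w2.length := by omega
      have d : w2 = w2.take t ++ w2[t] :: w2.drop (t + 1) := by simp
      refine beta_eq D (p := w1 ++ a :: b :: w2.take t) (p' := w1 ++ b :: a :: w2.take t) (i := w2[t]) (i' := w2[t])
        (r := w2.drop (t + 1)) (r' := w2.drop (t + 1)) ?_ ?_ k _ (by simp; omega) (by simp; omega) ?_
      · rw [hw]; conv_lhs => rw [d]
        simp
      · rw [hw']; conv_lhs => rw [d]
        simp
      · simp only [wordAct_append, wordAct, sref_far D hn h]

theorem pos_braid {w1 w2 : List I} {a b : I} (h : D.adj a b = true)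
    {w w' : List I} (hw : w = w1 ++ a :: b :: a :: w2) (hw' : w' = w1 ++ b :: a :: b :: w2) (hr : IsReducedWord D w')
    (k : Fin w.length) (k' : Fin w'.length) (hb : beta D w k = beta D w' k') :
    (k' : ℕ) = if (k : ℕ) = w1.length then w1.length + 2 else if (k : ℕ) = w1.length + 2 then w1.length else k := by
  have hba : D.adj b a = true := by rw [D.symm]; exact h
  have hl : w.length = w1.length + 3 + w2.length := by simp [hw]; omega
  have hl' : w'.length = w1.length + 3 + w2.length := by simp [hw']; omega
  have hk := k.2
  have fin : ∀ t : Fin w'.length, beta D w k = beta D w' t → (k' : ℕ) = t := by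
    intro t ht
    rw [beta_inj D w' hr k' t (hb.symm.trans ht)]
  split_ifs with c1 c2
  · refine fin ⟨w1.length + 2, by omega⟩ (beta_eq D (p := w1) (p' := w1 ++ [b, a]) (i := a) (i' := b) (r := b :: a :: w2)
      (r' := w2) hw (by simp [hw']) k _ c1 (by simp) ?_)
    rw [wordAct_append]; simp only [wordAct]; rw [root_braid D hba]
  · refine fin ⟨w1.length, by omega⟩ (beta_eq D (p := w1 ++ [a, b]) (p' := w1) (i := a) (i' := b) (r := w2)
      (r' := a :: b :: w2) (by simp [hw]) hw' k _ (by simp [c2]) (by simp) ?_)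
    rw [wordAct_append]; simp only [wordAct]; rw [root_braid D h]
  · refine fin ⟨k, by omega⟩ ?_
    rcases lt_or_ge (k : ℕ) w1.length with c | c
    · obtain ⟨p, i, r, hd, hp⟩ := split_at w1 k c
      exact beta_eq D (p := p) (p' := p) (i := i) (i' := i) (r := r ++ a :: b :: a :: w2)
        (r' := r ++ b :: a :: b :: w2) (by simp [hw, hd]) (by simp [hw', hd]) k _ hp.symm hp.symm rfl
    · by_cases c3 : (k : ℕ) = w1.length + 1
      · refine beta_eq D (p := w1 ++ [a]) (p' := w1 ++ [b]) (i := b) (i' := a) (r := a :: w2) (r' := b :: w2)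
          (by simp [hw]) (by simp [hw']) k _ (by simp [c3]) (by simp [c3]) ?_
        rw [wordAct_append, wordAct_append]; simp only [wordAct]; rw [root_mid D h]
      obtain ⟨t, ht⟩ : ∃ t, (k : ℕ) = w1.length + 3 + t := ⟨k - (w1.length + 3), by omega⟩
      have htl : t < w2.length := by omega
      have d : w2 = w2.take t ++ w2[t] :: w2.drop (t + 1) := by simp
      refine beta_eq D (p := w1 ++ a :: b :: a :: w2.take t) (p' := w1 ++ b :: a :: b :: w2.take t) (i := w2[t]) (i' := w2[t])
        (r := w2.drop (t + 1)) (r' := w2.drop (t + 1)) ?_ ?_ k _ (by simp; omega) (by simp; omega) ?_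
      · rw [hw]; conv_lhs => rw [d]
        simp
      · rw [hw']; conv_lhs => rw [d]
        simp
      · simp only [wordAct_append, wordAct, sref_braid D h]
end roots

section final
variable {I : Type} [Fintype I] [DecidableEq I] {D : ADEData I}

/-- the automorphism attached to a word -/
noncomputable def TA (T : I → (Uq D ≃ₐ[𝕂] Uq D)) : List I → (Uq D →ₐ[𝕂] Uq D)
  | [] => AlgHom.id 𝕂 (Uq D)
  | i :: l => ((T i : Uq D →ₐ[𝕂] Uq D)).comp (TA T l)

variable (T : I → (Uq D ≃ₐ[𝕂] Uq D))

theorem applyT_eq (l : List I) (x : Uq D) : applyT T l x = TA T l x := by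
  induction l with
  | nil => rfl
  | cons i l ih => simp only [applyT, ih, TA]; rfl

theorem TA_cons (i : I) (l : List I) (x : Uq D) : TA T (i :: l) x = T i (TA T l x) := rfl
theorem TA_nil (x : Uq D) : TA T [] x = x := rfl

theorem TA_append (l m : List I) (x : Uq D) : TA T (l ++ m) x = TA T l (TA T m x) := by
  induction l with
  | nil => rfl
  | cons i l ih => rw [List.cons_append, TA_cons, TA_cons, ih]

theorem TA_inj (l : List I) : Function.Injective (TA T l) := by
  induction l with
  | nil => exact fun _ _ h => h
  | cons i l ih => exact fun x y h => ih ((T i).injective h)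

theorem map_dp (f : Uq D →ₐ[𝕂] Uq D) (x : Uq D) (n : ℕ) : f (dp x n) = dp (f x) n := by
  simp only [dp, map_smul, map_pow]

/-- PBW monomials, recursively -/
noncomputable def P : List I → (ℕ → ℕ) → Uq D
  | [], _ => 1
  | i :: l, c => dp (FF D i) (c 0) * T i (P l (fun k => c (k + 1)))

theorem pbw_eq (w : List I) (c : ℕ → ℕ) : pbw T w (fun k => c k) = P T w c := by
  induction w generalizing c with
  | nil => simp [pbw, P]
  | cons i l ih =>
    rw [P, ← ih]
    unfold pbw
    change ((List.finRange (l.length + 1)).map _).prod = _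
    rw [List.finRange_succ, List.map_cons, List.prod_cons, List.map_map]
    congr 1
    rw [map_list_prod, List.map_map]
    congr 1
    apply List.map_congr_left
    intro k _
    exact (map_dp (T i : Uq D →ₐ[𝕂] Uq D) _ _).symm

theorem P_append (u v : List I) (c : ℕ → ℕ) :
    P T (u ++ v) c = P T u c * TA T u (P T v (fun k => c (k + u.length))) := by
  induction u generalizing c with
  | nil => simp [P, TA]
  | cons i l ih =>
    rw [List.cons_append, P, ih, P, TA_cons, map_mul, mul_assoc]
    congr 4

theorem P_congr (u : List I) (c d : ℕ → ℕ) (h : ∀ t, t < u.length → c t = d t) : P T u c = P T u d := by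
  induction u generalizing c d with
  | nil => rfl
  | cons i l ih =>
    rw [P, P, h 0 (by simp), ih _ (fun k => d (k + 1)) (fun t ht => h (t + 1) (by simpa using ht))]

theorem expand (w1 w2 m m' : List I) (L : ℕ) (hm : m.length = L) (hm' : m'.length = L)
    (hact : ∀ x, TA T m x = TA T m' x) (R : (ℕ → ℕ) → (ℕ → ℕ) → Prop)
    (hR : ∀ c e e', (∀ t, t < L → e t = e' t) → R c e → R c e')
    (hmid : ∀ c, P T m c ∈ Submodule.span 𝕂 {r | ∃ d, R c d ∧ r = P T m' d}) (c : ℕ → ℕ) :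
    P T (w1 ++ (m ++ w2)) c ∈ Submodule.span 𝕂 {r | ∃ d,
      R (fun k => c (k + w1.length)) (fun k => d (k + w1.length)) ∧
      (∀ t, t < w1.length ∨ w1.length + L ≤ t → d t = c t) ∧ r = P T (w1 ++ (m' ++ w2)) d} := by
  rw [P_append, P_append, hact]
  generalize hY : TA T m' (P T w2 (fun k => (fun k => c (k + w1.length)) (k + m.length))) = Y
  have h := hmid (fun k => c (k + w1.length))
  generalize P T m (fun k => c (k + w1.length)) = X at h ⊢
  induction h using Submodule.span_induction with
  | zero => simp
  | add x y _ _ hx hy => rw [add_mul, map_add, mul_add]; exact Submodule.add_mem _ hx hy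
  | smul k x _ hx => rw [smul_mul_assoc, map_smul, mul_smul_comm]; exact Submodule.smul_mem _ k hx
  | mem x hx =>
    obtain ⟨e, he, rfl⟩ := hx
    apply Submodule.subset_span
    refine ⟨fun t => if t < w1.length then c t else if t < w1.length + L then e (t - w1.length) else c t, ?_, ?_, ?_⟩
    · refine hR _ e _ (fun t ht => ?_) he
      have h1 : ¬ (t + w1.length < w1.length) := by omega
      have h2 : t + w1.length < w1.length + L := by omega
      simp only [h1, h2, if_true, if_false, Nat.add_sub_cancel]
    · rintro t (h | h)
      · simp only [h, if_true]
      · have h1 : ¬ (t < w1.length) := by omega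
        have h2 : ¬ (t < w1.length + L) := by omega
        simp only [h1, h2, if_false]
    · rw [P_append, P_append, ← hY]
      congr 1
      · apply P_congr
        intro t h
        simp only [h, if_true]
      · congr 2
        · apply P_congr
          intro t ht
          have h1 : ¬ (t + w1.length < w1.length) := by omega
          have h2 : t + w1.length < w1.length + L := by omega
          simp only [h1, h2, if_true, if_false, Nat.add_sub_cancel]
        · congr 1
          apply P_congr
          intro t ht
          have h1 : ¬ (t + m'.length + w1.length < w1.length) := by omega
          have h2 : ¬ (t + m'.length + w1.length < w1.length + L) := by omega
          rw [hm'] at h1 h2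
          rw [hm, hm']
          simp only [h1, h2, if_false]

theorem pbw_le (w w' w1 w2 m m' : List I) (L : ℕ) (hm : m.length = L) (hm' : m'.length = L)
    (hw : w = w1 ++ (m ++ w2)) (hw' : w' = w1 ++ (m' ++ w2))
    (hact : ∀ x, TA T m x = TA T m' x) (R : (ℕ → ℕ) → (ℕ → ℕ) → Prop)
    (hR : ∀ c e e', (∀ t, t < L → e t = e' t) → R c e → R c e')
    (hmid : ∀ c, P T m c ∈ Submodule.span 𝕂 {r | ∃ d, R c d ∧ r = P T m' d})
    (k₀ : Fin w.length) (k₀' : Fin w'.length) (n : ℕ)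
    (hk : ∀ c d : ℕ → ℕ, R (fun k => c (k + w1.length)) (fun k => d (k + w1.length)) →
      (∀ t, t < w1.length ∨ w1.length + L ≤ t → d t = c t) →
      (∀ t, t < w'.length → d t = if t = (k₀' : ℕ) then n else 0) →
      (∀ t, t < w.length → c t = if t = (k₀ : ℕ) then n else 0)) :
    Submodule.span 𝕂 {x : Uq D | ∃ a : Fin w.length → ℕ,
        a ≠ Pi.single k₀ n ∧ x = pbw T w a} ≤
    Submodule.span 𝕂 {x : Uq D | ∃ a : Fin w'.length → ℕ,
        a ≠ Pi.single k₀' n ∧ x = pbw T w' a} := by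
  rw [Submodule.span_le]
  rintro x ⟨a, ha, rfl⟩
  obtain ⟨c, rfl⟩ : ∃ c : ℕ → ℕ, a = fun k : Fin w.length => c k :=
    ⟨fun t => if h : t < w.length then a ⟨t, h⟩ else 0, by funext k; simp⟩
  rw [pbw_eq]
  have h := expand T w1 w2 m m' L hm hm' hact R hR hmid c
  rw [← hw] at h
  refine Submodule.span_mono ?_ h
  rintro _ ⟨d, hd1, hd2, rfl⟩
  refine ⟨fun k => d k, ?_, by rw [pbw_eq, hw']⟩
  intro e
  apply ha
  funext t
  have := hk c d hd1 hd2 (fun t ht => by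
    have := congrFun e ⟨t, ht⟩
    simp only [Pi.single_apply, Fin.ext_iff] at this
    exact this) t t.2
  simp only [Pi.single_apply, Fin.ext_iff]
  exact this

variable {T}

theorem far_le (hT : IsLusztigAuts D T) {w1 w2 : List I} {a b : I} (hn : a ≠ b) (h : D.adj a b = false)
    {w w' : List I} (hw : w = w1 ++ a :: b :: w2) (hw' : w' = w1 ++ b :: a :: w2) (hr : IsReducedWord D w')
    (k : Fin w.length) (k' : Fin w'.length) (hb : beta D w k = beta D w' k') (n : ℕ) :
    Submodule.span 𝕂 {x : Uq D | ∃ a : Fin w.length → ℕ,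
        a ≠ Pi.single k n ∧ x = pbw T w a} ≤
    Submodule.span 𝕂 {x : Uq D | ∃ a : Fin w'.length → ℕ,
        a ≠ Pi.single k' n ∧ x = pbw T w' a} := by
  have hba : D.adj b a = false := by rw [D.symm]; exact h
  have hpos := pos_far D hn h hw hw' hr k k' hb
  have hl : w.length = w1.length + 2 + w2.length := by simp [hw]; omega
  have hl' : w'.length = w1.length + 2 + w2.length := by simp [hw']; omega
  refine pbw_le T w w' w1 w2 [a, b] [b, a] 2 rfl rfl (by simp [hw]) (by simp [hw'])
    (fun x => by simp only [TA_cons, TA_nil]; exact far_comm hT hn h x)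
    (fun c d => d 0 = c 1 ∧ d 1 = c 0) ?_ ?_ k k' n ?_
  · rintro c e e' he ⟨h1, h2⟩
    exact ⟨by rw [← he 0 (by omega)]; exact h1, by rw [← he 1 (by omega)]; exact h2⟩
  · intro c
    apply Submodule.subset_span
    refine ⟨fun t => if t = 0 then c 1 else c 0, by simp, ?_⟩
    have e1 := map_dp (T a : Uq D →ₐ[𝕂] Uq D) (FF D b) (c 1)
    have e2 := map_dp (T b : Uq D →ₐ[𝕂] Uq D) (FF D a) (c 0)
    simp only [AlgHom.coe_coe, AlgEquiv.coe_toAlgHom] at e1 e2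
    simp only [P, map_one, mul_one, if_true, zero_add, one_ne_zero, if_false]
    rw [e1, e2, tFn hT hn h, tFn hT hn.symm hba]
    have hc : Commute (FF D a) (FF D b) := rFF a b hn h
    simp only [dp, smul_mul_assoc, mul_smul_comm, (hc.pow_pow (c 0) (c 1)).eq]
    rw [smul_comm]
  · intro c d ⟨h1, h2⟩ h3 h4 t ht
    simp only [zero_add] at h1 h2
    have a0 := h4 w1.length (by omega)
    have a1 := h4 (1 + w1.length) (by omega)
    have at' := h4 t (by omega)
    by_cases c0 : t = w1.length
    · subst c0; grind
    by_cases c1 : t = 1 + w1.length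
    · subst c1; grind
    have := h3 t (by omega)
    grind

theorem braid_le (hT : IsLusztigAuts D T) {w1 w2 : List I} {a b : I} (h : D.adj a b = true)
    {w w' : List I} (hw : w = w1 ++ a :: b :: a :: w2) (hw' : w' = w1 ++ b :: a :: b :: w2) (hr : IsReducedWord D w')
    (k : Fin w.length) (k' : Fin w'.length) (hb : beta D w k = beta D w' k') (n : ℕ)
    (hk : (k : ℕ) ≠ w1.length + 1) :
    Submodule.span 𝕂 {x : Uq D | ∃ a : Fin w.length → ℕ,
        a ≠ Pi.single k n ∧ x = pbw T w a} ≤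
    Submodule.span 𝕂 {x : Uq D | ∃ a : Fin w'.length → ℕ,
        a ≠ Pi.single k' n ∧ x = pbw T w' a} := by
  have hba : D.adj b a = true := by rw [D.symm]; exact h
  have hpos := pos_braid D h hw hw' hr k k' hb
  have hl : w.length = w1.length + 3 + w2.length := by simp [hw]; omega
  have hl' : w'.length = w1.length + 3 + w2.length := by simp [hw']; omega
  have hP : ∀ {a b : I}, D.adj a b = true → ∀ c : ℕ → ℕ, P T [a, b, a] c =
      ((qFact (c 0))⁻¹ * (qFact (c 1))⁻¹ * (qFact (c 2))⁻¹) •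
        (FF D a ^ c 0 * (FF D b * FF D a - qq • (FF D a * FF D b)) ^ c 1 * FF D b ^ c 2) := by
    intro a b h c
    have e1 := map_dp (T a : Uq D →ₐ[𝕂] Uq D) (FF D b) (c 1)
    have e2 := map_dp (T b : Uq D →ₐ[𝕂] Uq D) (FF D a) (c 2)
    have e3 := map_dp (T a : Uq D →ₐ[𝕂] Uq D) (T b (FF D a)) (c 2)
    simp only [AlgHom.coe_coe, AlgEquiv.coe_toAlgHom] at e1 e2 e3
    simp only [P, map_one, mul_one, zero_add, map_mul, Nat.reduceAdd]
    rw [e1, e2, e3, tFa hT h, TTF hT h]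
    simp only [dp, smul_mul_assoc, mul_smul_comm, smul_smul, mul_assoc]
    congr 1
    ring
  refine pbw_le T w w' w1 w2 [a, b, a] [b, a, b] 3 rfl rfl (by simp [hw]) (by simp [hw'])
    (fun x => by simp only [TA_cons, TA_nil]; exact braid hT h x)
    (fun c d => d 1 + d 2 = c 0 + c 1 ∧ d 0 + d 1 = c 1 + c 2) ?_ ?_ k k' n ?_
  · rintro c e e' he ⟨h1, h2⟩
    rw [he 1 (by omega), he 2 (by omega)] at h1
    rw [he 1 (by omega), he 0 (by omega)] at h2
    exact ⟨h1, h2⟩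
  · intro c
    rw [hP h]
    apply Submodule.smul_mem
    have key := serre_span qq qq_ne (FF D a) (FF D b) ?_ ?_ (c 0) (c 1) (c 2)
    · refine Submodule.span_le.mpr ?_ key
      rintro _ ⟨x, y, z, hx, hy, rfl⟩
      have e := hP hba (fun t => if t = 0 then x else if t = 1 then y else z)
      simp only [if_true, one_ne_zero, if_false, OfNat.ofNat_ne_zero, OfNat.ofNat_ne_one] at e
      have hne : ((qFact x)⁻¹ * (qFact y)⁻¹ * (qFact z)⁻¹) ≠ 0 :=
        mul_ne_zero (mul_ne_zero (inv_ne_zero (qFact_ne _)) (inv_ne_zero (qFact_ne _))) (inv_ne_zero (qFact_ne _))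
      have e' := (inv_smul_eq_iff₀ hne).mpr e
      rw [← e']
      refine Submodule.smul_mem _ _ (Submodule.subset_span ⟨_, ?_, rfl⟩)
      simp [hx, hy]
    · exact rSF a b h
    · exact rSF b a hba
  · intro c d ⟨h1, h2⟩ h3 h4 t ht
    simp only [zero_add] at h1 h2
    have a0 := h4 w1.length (by omega)
    have a1 := h4 (1 + w1.length) (by omega)
    have a2 := h4 (2 + w1.length) (by omega)
    have at' := h4 t (by omega)
    by_cases c0 : t = w1.length
    · subst c0; grind
    by_cases c1 : t = 1 + w1.length
    · subst c1; grind
    by_cases c2 : t = 2 + w1.length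
    · subst c2; grind
    have := h3 t (by omega)
    grind

theorem degen_le (hz : ∀ i, FF D i = 0) {w w' : List I} (k : Fin w.length) (k' : Fin w'.length) (n : ℕ) :
    Submodule.span 𝕂 {x : Uq D | ∃ a : Fin w.length → ℕ,
        a ≠ Pi.single k n ∧ x = pbw T w a} ≤
    Submodule.span 𝕂 {x : Uq D | ∃ a : Fin w'.length → ℕ,
        a ≠ Pi.single k' n ∧ x = pbw T w' a} := by
  have hrv : ∀ (w : List I) k, rootVec T w k = 0 := by
    intro w k; rw [rootVec, applyT_eq, hz, map_zero]
  have hp0 : ∀ w : List I, pbw T w 0 = 1 := by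
    intro w; simp [pbw, dp, qFact]
  rw [Submodule.span_le]
  rintro x ⟨a, ha, rfl⟩
  by_cases h0 : a = 0
  · subst h0
    apply Submodule.subset_span
    refine ⟨0, ?_, by rw [hp0, hp0]⟩
    intro e
    apply ha
    have := congrFun e k'
    simp only [Pi.single_eq_same, Pi.zero_apply] at this
    rw [← this, Pi.single_zero]
  · obtain ⟨j, hj⟩ := Function.ne_iff.mp h0
    have : pbw T w a = 0 := by
      unfold pbw
      apply List.prod_eq_zero
      refine List.mem_map.mpr ⟨j, List.mem_finRange j, ?_⟩
      rw [hrv, dp, zero_pow hj, smul_zero]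
    rw [this]; exact Submodule.zero_mem _

theorem rootVec_split (p r : List I) (i : I) (w : List I) (hw : w = p ++ i :: r) (k : Fin w.length)
    (hk : (k : ℕ) = p.length) : rootVec T w k = TA T p (FF D i) := by
  subst hw
  unfold rootVec
  have : (p ++ i :: r).get k = i := by simp [hk]
  rw [this, hk, applyT_eq]; simp

theorem gen_comm {K R : Type*} [Field K] [Ring R] [Algebra K R] (q : K) (hq : q + 1 ≠ 0) (A B : R)
    (h : B * A - q • (A * B) = A * B - q • (B * A)) : A * B = B * A := by
  have : (q + 1) • (A * B - B * A) = 0 := by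
    have h2 := sub_eq_zero.mpr h
    rw [← neg_eq_zero, ← h2]; module
  exact sub_eq_zero.mp ((smul_eq_zero.mp this).resolve_left hq)

theorem mid_zero (hT : IsLusztigAuts D T) {w1 w2 : List I} {a b : I} (h : D.adj a b = true)
    {w w' : List I} (hw : w = w1 ++ a :: b :: a :: w2) (hw' : w' = w1 ++ b :: a :: b :: w2)
    (k : Fin w.length) (k' : Fin w'.length) (hk : (k : ℕ) = w1.length + 1) (hk' : (k' : ℕ) = w1.length + 1)
    (hF : rootVec T w k = rootVec T w' k') (i : I) : FF D i = 0 := by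
  have hba : D.adj b a = true := by rw [D.symm]; exact h
  rw [rootVec_split (w1 ++ [a]) (a :: w2) b w (by simp [hw]) k (by simp [hk]),
    rootVec_split (w1 ++ [b]) (b :: w2) a w' (by simp [hw']) k' (by simp [hk']), TA_append, TA_append] at hF
  have h1 := TA_inj T w1 hF
  simp only [TA_cons, TA_nil] at h1
  rw [tFa hT h, tFa hT hba] at h1
  exact all_F_zero h (gen_comm qq qq_ne2 _ _ h1) i

end final

end SpanProof
/-- If `i`, `i'` are reduced expressions of `w₀` related by a
single braid move and `β` is a positive root whose root vector is the same for
both words, then for any `n` the span of the PBW monomials of `B_i` other than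
`F_β^{(n)}` equals the span of the PBW monomials of `B_{i'}` other than
`F_β^{(n)}`. -/
theorem span_complement_of_divided_power_eq
    {I : Type} [Fintype I] [DecidableEq I] (D : ADEData I)
    (T : I → (Uq D ≃ₐ[𝕂] Uq D)) (hT : IsLusztigAuts D T)
    (w w' : List I) (hw : IsRedW0 D w) (hw' : IsRedW0 D w')
    (hbm : BraidMove D w w')
    (βv : I → ℤ) (hβ : IsPosRoot D βv)
    (k₀ : Fin w.length) (k₀' : Fin w'.length)
    (hk₀ : beta D w k₀ = βv) (hk₀' : beta D w' k₀' = βv)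
    (hF : rootVec T w k₀ = rootVec T w' k₀') (n : ℕ) :
    Submodule.span 𝕂 {x : Uq D | ∃ a : Fin w.length → ℕ,
        a ≠ Pi.single k₀ n ∧ x = pbw T w a} =
    Submodule.span 𝕂 {x : Uq D | ∃ a : Fin w'.length → ℕ,
        a ≠ Pi.single k₀' n ∧ x = pbw T w' a} := by
  rcases hbm with ⟨w1, w2, a, b, hn, h, e, e'⟩ | ⟨w1, w2, a, b, h, e, e'⟩
  · have hba : D.adj b a = false := by rw [D.symm]; exact h
    exact le_antisymm (SpanProof.far_le hT hn h e e' hw'.1 k₀ k₀' (hk₀.trans hk₀'.symm) n)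
      (SpanProof.far_le hT hn.symm hba e' e hw.1 k₀' k₀ (hk₀'.trans hk₀.symm) n)
  · have hba : D.adj b a = true := by rw [D.symm]; exact h
    have hp := SpanProof.pos_braid D h e e' hw'.1 k₀ k₀' (hk₀.trans hk₀'.symm)
    by_cases hk : (k₀ : ℕ) = w1.length + 1
    · have hk' : (k₀' : ℕ) = w1.length + 1 := by
        rw [hp, hk]; simp
      have hz := SpanProof.mid_zero hT h e e' k₀ k₀' hk hk' hF
      exact le_antisymm (SpanProof.degen_le hz k₀ k₀' n) (SpanProof.degen_le hz k₀' k₀ n)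
    · have hk' : (k₀' : ℕ) ≠ w1.length + 1 := by
        rw [hp]; split_ifs <;> omega
      exact le_antisymm (SpanProof.braid_le hT h e e' hw'.1 k₀ k₀' (hk₀.trans hk₀'.symm) n hk)
        (SpanProof.braid_le hT hba e' e hw.1 k₀' k₀ (hk₀'.trans hk₀.symm) n hk')
end

section
/- The ℤ[q]-lattice 𝓛 := span_{ℤ[q]} B_i in U_q^-(𝔤) is independent of the choice of reduced expression i of w_0. -/
section PartA
variable {I : Type} [Fintype I] [DecidableEq I] (D : ADEData I)

def Bf (v u : I → ℤ) : ℤ := ∑ i, pairing D v i * u i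

theorem cartan_symm' (i j : I) : cartan D i j = cartan D j i := by
  unfold cartan cartanOf
  rw [D.symm i j]
  by_cases h : i = j
  · subst h; rfl
  · simp [h, Ne.symm h]

theorem pairing_add (v u : I → ℤ) (i : I) : pairing D (v + u) i = pairing D v i + pairing D u i := by
  simp [pairing, add_mul, Finset.sum_add_distrib]

theorem pairing_smul (c : ℤ) (v : I → ℤ) (i : I) : pairing D (c • v) i = c * pairing D v i := by
  simp [pairing, Finset.mul_sum, mul_assoc]

theorem pairing_simple (i j : I) : pairing D (simpleRoot i) j = cartan D i j := by
  simp [pairing, simpleRoot]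

theorem Bf_add_left (v u x : I → ℤ) : Bf D (v + u) x = Bf D v x + Bf D u x := by
  simp [Bf, pairing_add, add_mul, Finset.sum_add_distrib]

theorem Bf_smul_left (c : ℤ) (v x : I → ℤ) : Bf D (c • v) x = c * Bf D v x := by
  simp only [Bf, pairing_smul, Finset.mul_sum, mul_assoc]

theorem Bf_eq (v u : I → ℤ) : Bf D v u = ∑ i, ∑ j, cartan D i j * v j * u i := by
  unfold Bf pairing
  refine Finset.sum_congr rfl fun i _ => ?_
  rw [Finset.sum_mul]
  refine Finset.sum_congr rfl fun j _ => ?_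
  rw [cartan_symm' D i j]; ring

theorem Bf_comm (v u : I → ℤ) : Bf D v u = Bf D u v := by
  rw [Bf_eq, Bf_eq, Finset.sum_comm]
  refine Finset.sum_congr rfl fun i _ => Finset.sum_congr rfl fun j _ => ?_
  rw [cartan_symm' D i j]; ring

theorem Bf_add_right (v u x : I → ℤ) : Bf D x (v + u) = Bf D x v + Bf D x u := by
  rw [Bf_comm, Bf_add_left, Bf_comm, Bf_comm D u]

theorem Bf_smul_right (c : ℤ) (v x : I → ℤ) : Bf D x (c • v) = c * Bf D x v := by
  rw [Bf_comm, Bf_smul_left, Bf_comm]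

theorem Bf_simple (v : I → ℤ) (i : I) : Bf D v (simpleRoot i) = pairing D v i := by
  simp [Bf, simpleRoot]

theorem Bf_simple_self (i : I) : Bf D (simpleRoot i) (simpleRoot i) = 2 := by
  rw [Bf_simple, pairing_simple]; simp [cartan, cartanOf]

theorem sref_eq (i : I) (v : I → ℤ) : sref D i v = v + (-Bf D v (simpleRoot i)) • simpleRoot i := by
  funext j; simp [sref, Bf_simple, sub_eq_add_neg]

theorem sref_add (i : I) (v u : I → ℤ) : sref D i (v + u) = sref D i v + sref D i u := by
  simp only [sref_eq, Bf_add_left]; module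

theorem sref_smul (i : I) (c : ℤ) (v : I → ℤ) : sref D i (c • v) = c • sref D i v := by
  simp only [sref_eq, Bf_smul_left]; module

theorem sref_sref (i : I) (v : I → ℤ) : sref D i (sref D i v) = v := by
  simp only [sref_eq, Bf_add_left, Bf_smul_left, Bf_simple_self]; module

theorem sref_simple (i : I) : sref D i (simpleRoot i) = -simpleRoot i := by
  simp only [sref_eq, Bf_simple_self]; module

theorem Bf_sref (i : I) (v u : I → ℤ) : Bf D (sref D i v) (sref D i u) = Bf D v u := by
  simp only [sref_eq, Bf_add_left, Bf_smul_left, Bf_add_right, Bf_smul_right, Bf_simple_self,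
    Bf_comm D (simpleRoot i)]; ring

theorem wordAct_append (l m : List I) (v : I → ℤ) :
    wordAct D (l ++ m) v = wordAct D l (wordAct D m v) := by
  induction l with
  | nil => rfl
  | cons i l ih => simp [wordAct, ih]

theorem wordAct_add (l : List I) (v u : I → ℤ) :
    wordAct D l (v + u) = wordAct D l v + wordAct D l u := by
  induction l with
  | nil => rfl
  | cons i l ih => simp [wordAct, ih, sref_add]

theorem wordAct_smul (l : List I) (c : ℤ) (v : I → ℤ) :
    wordAct D l (c • v) = c • wordAct D l v := by
  induction l with
  | nil => rfl
  | cons i l ih => simp only [wordAct, ih, sref_smul]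

theorem wordAct_neg (l : List I) (v : I → ℤ) :
    wordAct D l (-v) = - wordAct D l v := by
  have := wordAct_smul D l (-1) v
  simpa using this

theorem Bf_wordAct (l : List I) (v u : I → ℤ) :
    Bf D (wordAct D l v) (wordAct D l u) = Bf D v u := by
  induction l with
  | nil => rfl
  | cons i l ih => simp [wordAct, ih, Bf_sref]

theorem wordAct_reverse_left (l : List I) (v : I → ℤ) :
    wordAct D l.reverse (wordAct D l v) = v := by
  induction l with
  | nil => rfl
  | cons i l ih => simp [wordAct, wordAct_append, sref_sref, ih]

theorem wordAct_reverse_right (l : List I) (v : I → ℤ) :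
    wordAct D l (wordAct D l.reverse v) = v := by
  have := wordAct_reverse_left D l.reverse v
  simpa using this

theorem Bf_pos (v : I → ℤ) (hv : v ≠ 0) : 0 < Bf D v v := by
  have h := D.posdef (fun i => (v i : ℚ)) (by
    intro h; apply hv; funext i; have := congrFun h i; simpa using this)
  have h2 : ((Bf D v v : ℤ) : ℚ) = ∑ i, ∑ j, (cartanOf D.adj i j : ℚ) * v i * v j := by
    rw [Bf_eq]; push_cast
    refine Finset.sum_congr rfl fun i _ => Finset.sum_congr rfl fun j _ => ?_
    unfold cartan; ring
  rw [← h2] at h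
  exact_mod_cast h

theorem Bf_even (v : I → ℤ) : Even (Bf D v v) := by
  rw [← ZMod.intCast_eq_zero_iff_even, Bf_eq]
  push_cast
  rw [← Finset.sum_product']
  refine Finset.sum_involution (fun a _ => (a.2, a.1)) ?_ ?_ ?_ ?_
  · intro a _
    rw [cartan_symm' D a.2 a.1]
    have : ((cartan D a.1 a.2 : ZMod 2) * v a.2 * v a.1) + (cartan D a.1 a.2 * v a.1 * v a.2)
      = 2 * (cartan D a.1 a.2 * v a.1 * v a.2) := by ring
    rw [this, show (2 : ZMod 2) = 0 from rfl, zero_mul]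
  · intro a _ h heq
    apply h
    have : a.2 = a.1 := congrArg Prod.fst heq
    rw [this]
    have h2 : cartan D a.1 a.1 = 2 := by simp [cartan, cartanOf]
    rw [h2]
    push_cast
    rw [show (2 : ZMod 2) = 0 from rfl, zero_mul, zero_mul]
  · simp
  · simp

def Pos (v : I → ℤ) : Prop := ∀ j, 0 ≤ v j

theorem root_sign (v : I → ℤ) (hv : Bf D v v = 2) : Pos v ∨ Pos (-v) := by
  by_contra hc
  push Not at hc
  obtain ⟨h1, h2⟩ := hc
  set p : I → ℤ := fun i => max (v i) 0
  set n : I → ℤ := fun i => max (-v i) 0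
  have hvpn : v = p + (-1 : ℤ) • n := by
    funext i; simp [p, n]; grind
  have hp : p ≠ 0 := by
    intro h; apply h2; intro j; have := congrFun h j; simp [p] at this; simpa using this
  have hn : n ≠ 0 := by
    intro h; apply h1; intro j; have := congrFun h j; simp [n] at this; simpa using this
  have hpp := Bf_pos D p hp
  have hnn := Bf_pos D n hn
  have hpn : Bf D p n ≤ 0 := by
    rw [Bf_eq]
    refine Finset.sum_nonpos fun i _ => Finset.sum_nonpos fun j _ => ?_
    by_cases h : i = j
    · subst h
      have : p i * n i = 0 := by simp only [p, n, mul_eq_zero]; grind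
      rw [mul_assoc, this, mul_zero]
    · have hc : cartan D i j ≤ 0 := by
        simp only [cartan, cartanOf, h, if_false]; split <;> simp
      have h3 : 0 ≤ p j := le_max_right _ _
      have h4 : 0 ≤ n i := le_max_right _ _
      exact mul_nonpos_of_nonpos_of_nonneg (mul_nonpos_of_nonpos_of_nonneg hc h3) h4
  have e1 := Bf_even D p
  have e2 := Bf_even D n
  rw [hvpn] at hv
  simp only [Bf_add_left, Bf_smul_left, Bf_add_right, Bf_smul_right, Bf_comm D n p] at hv
  obtain ⟨a, ha⟩ := e1
  obtain ⟨b, hb⟩ := e2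
  omega

theorem Bf_root (l : List I) (i : I) :
    Bf D (wordAct D l (simpleRoot i)) (wordAct D l (simpleRoot i)) = 2 := by
  rw [Bf_wordAct, Bf_simple_self]

theorem pos_not_neg (v : I → ℤ) (hv : Bf D v v = 2) (h : Pos v) : ¬ Pos (-v) := by
  intro h'
  have : v = 0 := by
    funext j; have := h j; have := h' j; simp at *; omega
  subst this
  simp [Bf_eq] at hv

theorem pos_simple (i : I) : Pos (simpleRoot i) := by
  intro j; unfold simpleRoot; split <;> simp

theorem sref_pos (i : I) (v : I → ℤ) (hv : Bf D v v = 2) (h : Pos v) (hne : v ≠ simpleRoot i) :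
    Pos (sref D i v) := by
  have h2 : Bf D (sref D i v) (sref D i v) = 2 := by rw [Bf_sref, hv]
  rcases root_sign D _ h2 with h3 | h3
  · exact h3
  · exfalso
    have h0 : ∀ j, j ≠ i → v j = 0 := by
      intro j hj
      have := h3 j
      have := h j
      simp [sref, simpleRoot, hj] at *
      omega
    have hv' : v = v i • simpleRoot i := by
      funext j
      by_cases hj : j = i
      · subst hj; simp [simpleRoot]
      · simp [simpleRoot, hj, h0 j hj]
    have h5 := hv
    rw [hv'] at h5
    simp only [Bf_smul_left, Bf_smul_right, Bf_simple_self] at h5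
    have h6 := h i
    have : v i = 1 := by nlinarith
    rw [this, one_smul] at hv'
    exact hne hv'

theorem flip_exists (w : List I) : ∀ v : I → ℤ, Bf D v v = 2 → Pos v →
    ¬ Pos (wordAct D w.reverse v) →
    ∃ w1 j w2, w = w1 ++ j :: w2 ∧ wordAct D w1.reverse v = simpleRoot j := by
  induction w with
  | nil => intro v _ h h'; exact absurd h h'
  | cons k w ih =>
    intro v hv h h'
    by_cases hk : v = simpleRoot k
    · exact ⟨[], k, w, rfl, hk⟩
    · obtain ⟨w1, j, w2, e, h3⟩ := ih (sref D k v) (by rw [Bf_sref, hv]) (sref_pos D k v hv h hk) (by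
        simpa [wordAct_append, wordAct] using h')
      exact ⟨k :: w1, j, w2, by simp [e], by simpa [wordAct_append, wordAct] using h3⟩

theorem wordAct_conj (r : List I) (i j : I) (h : wordAct D r (simpleRoot i) = simpleRoot j)
    (v : I → ℤ) : wordAct D r (sref D i v) = sref D j (wordAct D r v) := by
  rw [sref_eq, sref_eq, wordAct_add, wordAct_smul, h, ← h, Bf_wordAct]

theorem exchange (w : List I) (i : I) (h : ¬ Pos (wordAct D w.reverse (simpleRoot i))) :
    ∃ w1 j w2, w = w1 ++ j :: w2 ∧ wordAct D (i :: w) = wordAct D (w1 ++ w2) := by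
  obtain ⟨w1, j, w2, e, h3⟩ := flip_exists D w _ (Bf_simple_self D i) (pos_simple i) h
  refine ⟨w1, j, w2, e, ?_⟩
  have h4 : wordAct D w1 (simpleRoot j) = simpleRoot i := by
    rw [← h3, wordAct_reverse_right]
  funext v
  rw [e]
  simp only [wordAct, wordAct_append]
  rw [← wordAct_conj D w1 j i h4, sref_sref]

/-- `i` is a left descent. -/
theorem descent_of_cons (i : I) (u : List I) (h : IsReducedWord D (i :: u)) :
    ¬ Pos (wordAct D (i :: u).reverse (simpleRoot i)) := by
  simp only [List.reverse_cons, wordAct_append, wordAct, sref_simple, wordAct_neg]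
  have hp : Pos (wordAct D u.reverse (simpleRoot i)) := by
    by_contra hc
    obtain ⟨w1, j, w2, e, h2⟩ := exchange D u i hc
    have := h _ h2.symm
    simp [e] at this
  exact pos_not_neg D _ (Bf_root D _ _) hp

theorem act_reverse_congr {u v : List I} (h : wordAct D u = wordAct D v) :
    wordAct D u.reverse = wordAct D v.reverse := by
  funext x
  rw [← wordAct_reverse_left D v (wordAct D u.reverse x), ← h, wordAct_reverse_right]

theorem reduced_tail {i : I} {u : List I} (h : IsReducedWord D (i :: u)) : IsReducedWord D u := by
  intro w' hw'
  have := h (i :: w') (by funext v; simp [wordAct, hw'])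
  simpa using this

theorem reduced_of_eq {u v : List I} (hu : IsReducedWord D u) (h : wordAct D u = wordAct D v)
    (hl : v.length = u.length) : IsReducedWord D v := by
  intro w' hw'
  rw [hl]; exact hu w' (by rw [hw', h])

theorem act_cons_cancel {i : I} {u v : List I} (h : wordAct D (i :: u) = wordAct D (i :: v)) :
    wordAct D u = wordAct D v := by
  funext x
  have := congrArg (sref D i) (congrFun h x)
  simpa [wordAct, sref_sref] using this

theorem act_surj (u : List I) (x : I → ℤ) : ∃ y, wordAct D u y = x :=
  ⟨_, wordAct_reverse_right D u x⟩

theorem act_append_cancel {p p' u : List I} (h : wordAct D (p ++ u) = wordAct D (p' ++ u)) :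
    wordAct D p = wordAct D p' := by
  funext x
  obtain ⟨y, rfl⟩ := act_surj D u x
  have := congrFun h y
  simpa [wordAct_append] using this

theorem sref_inj {i j : I} (h : wordAct D [i] = wordAct D [j]) : i = j := by
  by_contra hne
  have h1 := congrFun (congrFun h (simpleRoot i)) i
  simp [wordAct, sref_simple] at h1
  simp [sref, simpleRoot, hne] at h1

theorem Bf_simple_adj {i j : I} (h : D.adj i j = true) :
    Bf D (simpleRoot i) (simpleRoot j) = -1 := by
  rw [Bf_simple, pairing_simple, cartan, cartanOf, if_neg, if_pos h]
  rintro rfl; simp [D.irrefl] at h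

theorem Bf_simple_far {i j : I} (hne : i ≠ j) (h : D.adj i j = false) :
    Bf D (simpleRoot i) (simpleRoot j) = 0 := by
  rw [Bf_simple, pairing_simple, cartan, cartanOf, if_neg hne]; simp [h]

theorem ne_of_adj {i j : I} (h : D.adj i j = true) : i ≠ j := by
  rintro rfl; simp [D.irrefl] at h

theorem adj_symm {i j : I} (h : D.adj i j = true) : D.adj j i = true := by
  rw [D.symm, h]

theorem far_symm {i j : I} (h : D.adj i j = false) : D.adj j i = false := by
  rw [D.symm, h]

theorem act_far {i j : I} (hne : i ≠ j) (h : D.adj i j = false) (u : List I) :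
    wordAct D (i :: j :: u) = wordAct D (j :: i :: u) := by
  funext v
  simp only [wordAct, sref_eq, Bf_add_left, Bf_smul_left, Bf_simple_far D hne h,
    Bf_simple_far D hne.symm (far_symm D h)]
  module

theorem act_adj {i j : I} (h : D.adj i j = true) (u : List I) :
    wordAct D (i :: j :: i :: u) = wordAct D (j :: i :: j :: u) := by
  funext v
  simp only [wordAct, sref_eq, Bf_add_left, Bf_smul_left, Bf_simple_adj D h,
    Bf_simple_adj D (adj_symm D h), Bf_simple_self]
  module

theorem act_adj_ne {i j : I} (h : D.adj i j = true) :
    wordAct D [i, j] ≠ wordAct D [j, i] := by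
  intro he
  have h1 := congrFun (congrFun he (simpleRoot i)) i
  have hn := ne_of_adj D h
  simp only [wordAct, sref_eq, Bf_add_left, Bf_smul_left, Bf_simple_adj D h,
    Bf_simple_adj D (adj_symm D h), Bf_simple_self] at h1
  simp [simpleRoot, hn] at h1

theorem matsumoto (R : List I → List I → Prop) (hR : Equivalence R)
    (hcons : ∀ i u v, R u v → R (i :: u) (i :: v))
    (hfar : ∀ i j u, i ≠ j → D.adj i j = false → R (i :: j :: u) (j :: i :: u))
    (hadj : ∀ i j u, D.adj i j = true → R (i :: j :: i :: u) (j :: i :: j :: u)) :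
    ∀ (n : ℕ) (u v : List I), u.length = n → IsReducedWord D u → IsReducedWord D v →
      wordAct D u = wordAct D v → R u v := by
  intro n
  induction n with
  | zero =>
    intro u v hl hu hv he
    have h1 := hv u he
    rw [hl] at h1
    rw [List.length_eq_zero_iff.mp hl, List.length_eq_zero_iff.mp (Nat.le_zero.mp h1)]
    exact hR.refl _
  | succ n ih =>
    intro u v hl hu hv he
    have hlv : v.length = n + 1 := by
      have h1 := hv u he
      have h2 := hu v he.symm
      omega
    match u, v, hl, hlv, hu, hv, he with
    | i :: u, j :: v, hl, hlv, hu, hv, he =>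
    have step : ∀ (i : I) (u v : List I), u.length = n → v.length = n →
        IsReducedWord D (i :: u) → wordAct D (i :: u) = wordAct D (i :: v) →
        R (i :: u) (i :: v) := by
      intro i u v hl hl' hu he
      have he' := act_cons_cancel D he
      exact hcons _ _ _ (ih u v hl (reduced_tail D hu)
        (reduced_of_eq D (reduced_tail D hu) he' (by omega)) he')
    simp only [List.length_cons, Nat.add_right_cancel_iff] at hl hlv
    by_cases hij : i = j
    · subst hij
      exact step i u v hl hlv hu he
    have hdi := descent_of_cons D i u hu
    rw [act_reverse_congr D he] at hdi
    obtain ⟨w1, k, w2, e, h2⟩ := exchange D (j :: v) i hdi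
    have h2' : wordAct D (j :: v) = wordAct D (i :: (w1 ++ w2)) := by
      funext x
      have := congrFun h2 x
      simp only [wordAct] at this ⊢
      rw [← this, sref_sref]
    cases w1 with
    | nil =>
      exfalso
      simp only [List.nil_append, List.cons.injEq] at e h2'
      obtain ⟨rfl, rfl⟩ := e
      exact hij (sref_inj D (act_append_cancel D (p := [j]) (p' := [i]) h2')).symm
    | cons k' w1 =>
      simp only [List.cons_append, List.cons.injEq] at e h2'
      obtain ⟨rfl, e⟩ := e
      set r := w1 ++ w2 with hr
      have hrl : r.length + 1 = n := by
        rw [← hlv, e]; simp [hr]; omega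
      have hu1 : R (i :: u) (i :: j :: r) :=
        step i u (j :: r) hl (by simp [hrl]) hu (by rw [he, h2'])
      cases ha : D.adj i j with
      | false =>
        have hf := act_far D hij ha r
        refine hR.trans hu1 (hR.trans (hfar i j r hij ha) (hR.symm ?_))
        exact step j v (i :: r) hlv (by simp [hrl]) hv (by rw [h2', hf])
      | true =>
        have hred : IsReducedWord D (i :: j :: r) :=
          reduced_of_eq D hv h2' (by simp; omega)
        have hdj := descent_of_cons D j v hv
        rw [act_reverse_congr D h2'] at hdj
        obtain ⟨x1, k, x2, e3, h3⟩ := exchange D (i :: j :: r) j hdj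
        have h3' : wordAct D (i :: j :: r) = wordAct D (j :: (x1 ++ x2)) := by
          funext x
          have := congrFun h3 x
          simp only [wordAct] at this ⊢
          rw [← this, sref_sref]
        match x1, e3, h3' with
        | [], e3, h3' =>
          exfalso
          simp only [List.nil_append, List.cons.injEq] at e3 h3'
          obtain ⟨rfl, rfl⟩ := e3
          have := hred r (by rw [h3']; funext x; simp [wordAct, sref_sref])
          simp at this
        | [k1], e3, h3' =>
          exfalso
          simp only [List.cons_append, List.nil_append, List.cons.injEq] at e3 h3'
          obtain ⟨rfl, rfl, rfl⟩ := e3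
          exact act_adj_ne D ha (act_append_cancel D (p := [i, j]) (p' := [j, i]) h3')
        | k1 :: k2 :: x1, e3, h3' =>
          simp only [List.cons_append, List.cons.injEq] at e3 h3'
          obtain ⟨rfl, rfl, e3⟩ := e3
          have hxl : (x1 ++ x2).length + 1 = r.length := by
            rw [e3]; simp; omega
          have hb := act_adj D ha (x1 ++ x2)
          have hu2 : R (i :: u) (i :: j :: i :: (x1 ++ x2)) :=
            step i u _ hl (by simp at hxl ⊢; omega) hu (by rw [he, h2', h3', hb])
          have hv2 : R (j :: v) (j :: i :: j :: (x1 ++ x2)) :=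
            step j v _ hlv (by simp at hxl ⊢; omega) hv (by rw [h2', h3'])
          exact hR.trans hu2 (hR.trans (hadj i j _ ha) (hR.symm hv2))

theorem reduced_cons (w : List I) (hw : IsReducedWord D w) (i : I)
    (h : Pos (wordAct D w.reverse (simpleRoot i))) : IsReducedWord D (i :: w) := by
  intro v hv
  by_contra hc
  simp only [List.length_cons, not_le] at hc
  have h1 : ¬ Pos (wordAct D v.reverse (simpleRoot i)) := by
    rw [act_reverse_congr D hv]
    simp only [List.reverse_cons, wordAct_append, wordAct, sref_simple, wordAct_neg]
    exact pos_not_neg D _ (Bf_root D _ _) h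
  obtain ⟨w1, j, w2, e, h2⟩ := exchange D v i h1
  have h3 : wordAct D (w1 ++ w2) = wordAct D w := by
    rw [← h2]; funext x; simp [wordAct, hv, sref_sref]
  have := hw _ h3
  rw [e] at hc
  simp at this hc
  omega

theorem w0_neg (w : List I) (hw : IsRedW0 D w) (i : I) :
    ¬ Pos (wordAct D w.reverse (simpleRoot i)) := by
  intro h
  have := hw.2 _ (reduced_cons D w hw.1 i h)
  simp at this

theorem sum_simple (v : I → ℤ) : v = ∑ i, v i • simpleRoot i := by
  funext j; simp [simpleRoot]

theorem wordAct_sum (l : List I) (c : I → ℤ) :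
    wordAct D l (∑ i, c i • simpleRoot i) = ∑ i, c i • wordAct D l (simpleRoot i) := by
  let f : (I → ℤ) →+ (I → ℤ) := AddMonoidHom.mk' (wordAct D l) (wordAct_add D l)
  have : wordAct D l = f := rfl
  rw [this, map_sum]
  simp only [map_zsmul]

theorem w0_neg_root (w : List I) (hw : IsRedW0 D w) (v : I → ℤ) (hv : Pos v) :
    Pos (-wordAct D w.reverse v) := by
  rw [sum_simple v, wordAct_sum]
  intro j
  simp only [Pi.neg_apply, Finset.sum_apply, Pi.smul_apply, smul_eq_mul]
  rw [← Finset.sum_neg_distrib]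
  refine Finset.sum_nonneg fun i _ => ?_
  have h1 := ((root_sign D _ (Bf_root D w.reverse i)).resolve_left (w0_neg D w hw i)) j
  have := mul_nonneg (hv i) h1
  simp at this ⊢
  linarith

theorem w0_pos (w w' : List I) (hw : IsRedW0 D w) (hw' : IsRedW0 D w') (i : I) :
    Pos (wordAct D (w'.reverse ++ w) (simpleRoot i)) := by
  rw [wordAct_append]
  have h1 : Pos (-wordAct D w (simpleRoot i)) := by
    rcases root_sign D _ (Bf_root D w i) with h | h
    · have := w0_neg_root D w hw _ h
      rw [wordAct_reverse_left] at this
      exact absurd this (pos_not_neg D _ (Bf_simple_self D i) (pos_simple i))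
    · exact h
  have := w0_neg_root D w' hw' _ h1
  rwa [wordAct_neg, neg_neg] at this

theorem exists_reduced (u : List I) : ∃ r, IsReducedWord D r ∧ wordAct D r = wordAct D u := by
  classical
  have hne : ∃ n, ∃ r : List I, r.length = n ∧ wordAct D r = wordAct D u := ⟨_, u, rfl, rfl⟩
  obtain ⟨r, h1, h2⟩ := Nat.find_spec hne
  refine ⟨r, fun w' hw' => ?_, h2⟩
  rw [h1]
  exact Nat.find_min' hne ⟨w', rfl, by rw [hw', h2]⟩

theorem w0_unique (w w' : List I) (hw : IsRedW0 D w) (hw' : IsRedW0 D w') :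
    wordAct D w = wordAct D w' := by
  obtain ⟨r, hr, he⟩ := exists_reduced D (w.reverse ++ w')
  cases r with
  | nil =>
    funext x
    have := congrArg (wordAct D w) (congrFun he x)
    rwa [wordAct_append, wordAct_reverse_right] at this
  | cons i r =>
    exfalso
    apply descent_of_cons D i r hr
    rw [act_reverse_congr D he]
    simpa using w0_pos D w w' hw hw' i

end PartA

section PartB
open Polynomial

theorem qq_ne : qq ≠ 0 := RatFunc.X_ne_zero

theorem qq_pow_ne_one (n : ℕ) (hn : 0 < n) : qq ^ n ≠ 1 := by
  intro h
  have h1 : (algebraMap ℚ[X] 𝕂) (X ^ n) = algebraMap ℚ[X] 𝕂 1 := by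
    rw [map_pow, RatFunc.algebraMap_X, map_one]; exact h
  have h2 := RatFunc.algebraMap_injective ℚ h1
  have h3 := congrArg natDegree h2
  simp at h3
  omega

theorem qq_sub_ne : qq - qq⁻¹ ≠ 0 := by
  intro h
  apply qq_pow_ne_one 2 (by norm_num)
  have := qq_ne
  field_simp at h
  linear_combination h

/-- quantum integers, with integer index -/
noncomputable def qz (n : ℤ) : 𝕂 := (qq ^ n - qq ^ (-n)) / (qq - qq⁻¹)

theorem qz_zero : qz 0 = 0 := by simp [qz]

theorem qz_add (a b : ℤ) : qz (a + b) = qq ^ b * qz a + qq ^ (-a) * qz b := by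
  have h := qq_sub_ne
  have h0 := qq_ne
  unfold qz
  rw [mul_div_assoc', mul_div_assoc', ← add_div]
  congr 1
  rw [neg_add, zpow_add₀ h0, zpow_add₀ h0]
  ring

theorem qz_one : qz 1 = 1 := by
  unfold qz; simp [div_self qq_sub_ne]

theorem qInt_eq (n : ℕ) : qInt n = qz n := by
  have h0 := qq_ne
  induction n with
  | zero => simp [qInt, qz_zero]
  | succ n ih =>
    have : qInt (n + 1) = qq * qInt n + qq ^ (-(n : ℤ)) := by
      unfold qInt
      rw [Finset.sum_range_succ, Finset.mul_sum]
      congr 1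
      · refine Finset.sum_congr rfl fun t _ => ?_
        rw [← zpow_one_add₀ h0]; congr 1; push_cast; ring
      · congr 1; push_cast; ring
    rw [this, ih]; push_cast
    rw [qz_add, qz_one]; simp

theorem qz_ne (n : ℕ) : qz ((n : ℤ) + 1) ≠ 0 := by
  unfold qz
  have h0 := qq_ne
  refine div_ne_zero ?_ qq_sub_ne
  intro h
  apply qq_pow_ne_one (2 * (n + 1)) (by omega)
  have h1 : qq ^ ((n : ℤ) + 1) * (qq ^ ((n : ℤ) + 1) - qq ^ (-((n : ℤ) + 1))) = 0 := by rw [h, mul_zero]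
  rw [mul_sub, ← zpow_add₀ h0, ← zpow_add₀ h0, add_neg_cancel, zpow_zero] at h1
  have h2 : qq ^ (2 * (n + 1)) = qq ^ ((n : ℤ) + 1 + (n + 1)) := by
    rw [← zpow_natCast]; congr 1; push_cast; ring
  rw [h2]; linear_combination h1

theorem qFact_succ (n : ℕ) : qFact (n + 1) = qFact n * qz ((n : ℤ) + 1) := by
  rw [qFact, Finset.prod_range_succ, qInt_eq]; push_cast; rfl

theorem qFact_zero : qFact 0 = 1 := by simp [qFact]

theorem qFact_ne (n : ℕ) : qFact n ≠ 0 := by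
  induction n with
  | zero => simp [qFact_zero]
  | succ n ih => rw [qFact_succ]; exact mul_ne_zero ih (qz_ne n)

/-- image of `ℤ[q]` -/
noncomputable def PP : Subring 𝕂 := (algebraMap ℤ[X] 𝕂).range

theorem qq_mem : qq ∈ PP := ⟨X, by
  change (Polynomial.aeval qq : ℤ[X] →ₐ[ℤ] 𝕂) X = qq
  simp⟩

theorem qq_zpow_mem (n : ℤ) (h : 0 ≤ n) : qq ^ n ∈ PP := by
  obtain ⟨m, rfl⟩ := Int.eq_ofNat_of_zero_le h
  rw [zpow_natCast]; exact pow_mem qq_mem m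

noncomputable def Gb (a b : ℕ) : 𝕂 := qFact (a + b) / (qFact a * qFact b)

theorem Gb_zero_right (a : ℕ) : Gb a 0 = 1 := by
  have := qFact_ne a
  simp [Gb, qFact_zero, div_self this]

theorem Gb_zero_left (a : ℕ) : Gb 0 a = 1 := by
  have := qFact_ne a
  simp [Gb, qFact_zero, div_self this]

theorem Gb_rec (a b : ℕ) :
    Gb (a + 1) (b + 1) = qq ^ ((b : ℤ) + 1) * Gb a (b + 1) + qq ^ (-((a : ℤ) + 1)) * Gb (a + 1) b := by
  have h1 := qFact_ne a
  have h2 := qFact_ne b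
  have h3 := qz_ne a
  have h4 := qz_ne b
  unfold Gb
  rw [show a + 1 + (b + 1) = (a + b + 1) + 1 by ring, show a + (b + 1) = a + b + 1 by ring,
    show a + 1 + b = a + b + 1 by ring, qFact_succ (a + b + 1), qFact_succ a, qFact_succ b]
  have : qz (((a + b + 1 : ℕ) : ℤ) + 1) = qz (((a : ℤ) + 1) + ((b : ℤ) + 1)) := by
    congr 1; push_cast; ring
  rw [this, qz_add]
  generalize qq ^ ((b : ℤ) + 1) = s
  generalize qq ^ (-((a : ℤ) + 1)) = t
  field_simp

theorem Gb_mem (a b : ℕ) : qq ^ ((a : ℤ) * b) * Gb a b ∈ PP := by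
  have h0 := qq_ne
  induction a generalizing b with
  | zero => simp [Gb_zero_left, one_mem]
  | succ a iha =>
    induction b with
    | zero => simp [Gb_zero_right, one_mem]
    | succ b ihb =>
      rw [Gb_rec, mul_add]
      refine add_mem ?_ ?_
      · have h1 := mul_mem (qq_zpow_mem (2 * ((b : ℤ) + 1)) (by positivity)) (iha (b + 1))
        convert h1 using 1
        rw [← mul_assoc, ← mul_assoc, ← zpow_add₀ h0, ← zpow_add₀ h0]
        congr 2; push_cast; ring
      · convert ihb using 1
        rw [← mul_assoc, ← zpow_add₀ h0]
        congr 2; push_cast; ring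

theorem Gb_mem' (a b : ℕ) (n : ℤ) (h : (a : ℤ) * b ≤ n) : qq ^ n * Gb a b ∈ PP := by
  have h1 := mul_mem (qq_zpow_mem (n - (a : ℤ) * b) (by omega)) (Gb_mem a b)
  rwa [← mul_assoc, ← zpow_add₀ qq_ne, sub_add_cancel] at h1

variable {A : Type*} [Ring A] [Algebra 𝕂 A]

noncomputable def dq (x : A) (n : ℕ) : A := (qFact n)⁻¹ • x ^ n

noncomputable def dz (x : A) (k : ℤ) : A := if 0 ≤ k then dq x k.toNat else 0

theorem dz_nat (x : A) (n : ℕ) : dz x (n : ℤ) = dq x n := by simp [dz]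

theorem dz_neg (x : A) (k : ℤ) (h : k < 0) : dz x k = 0 := by
  simp [dz, not_le.mpr h]

theorem dq_zero (x : A) : dq x 0 = 1 := by simp [dq, qFact_zero]

theorem dq_succ (x : A) (n : ℕ) : x * dq x n = qz ((n : ℤ) + 1) • dq x (n + 1) := by
  have h := qz_ne n
  have h' := qFact_ne n
  rw [dq, dq, qFact_succ, smul_smul, mul_smul_comm, pow_succ']
  congr 1
  field_simp

theorem dz_succ (x : A) (k : ℤ) : x * dz x k = qz (k + 1) • dz x (k + 1) := by
  rcases lt_or_ge k 0 with h | h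
  · rw [dz_neg x k h, mul_zero]
    rcases eq_or_ne k (-1) with rfl | h1
    · simp [qz_zero]
    · rw [dz_neg x (k + 1) (by omega), smul_zero]
  · obtain ⟨n, rfl⟩ := Int.eq_ofNat_of_zero_le h
    rw [dz_nat, dq_succ, ← dz_nat]; push_cast; rfl

theorem dz_comm (x : A) (k : ℤ) : x * dz x k = dz x k * x := by
  unfold dz dq
  split
  · rw [mul_smul_comm, smul_mul_assoc, (Commute.self_pow x _).eq]
  · simp

theorem dz_succ' (x : A) (k : ℤ) : dz x k * x = qz (k + 1) • dz x (k + 1) := by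
  rw [← dz_comm, dz_succ]

theorem dq_mul (x : A) (a b : ℕ) : dq x a * dq x b = Gb a b • dq x (a + b) := by
  have h := qFact_ne a
  have h' := qFact_ne b
  have h'' := qFact_ne (a + b)
  simp only [dq, smul_mul_smul_comm, ← pow_add, smul_smul, Gb]
  congr 1
  field_simp

theorem smul_cancel {c : 𝕂} (hc : c ≠ 0) {a b : A} (h : c • a = c • b) : a = b := by
  have := congrArg (fun t => c⁻¹ • t) h
  simpa [smul_smul, inv_mul_cancel₀ hc] using this

theorem y_dz_x {x y z : A} (h1 : y * x = z + qq • (x * y)) (h2 : z * x = qq⁻¹ • (x * z)) (k : ℤ) :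
    y * dz x k = qq ^ k • (dz x k * y) + dz x (k - 1) * z := by
  have h0 := qq_ne
  rcases lt_or_ge k 0 with h | h
  · simp [dz_neg x k h, dz_neg x (k - 1) (by omega)]
  obtain ⟨n, rfl⟩ := Int.eq_ofNat_of_zero_le h
  clear h
  induction n with
  | zero => simp [dz, dq_zero]
  | succ n ih =>
    refine smul_cancel (qz_ne n) ?_
    have e : (((n + 1 : ℕ) : ℤ)) = (n : ℤ) + 1 := by push_cast; rfl
    have ih := ih
    rw [e, ← mul_smul_comm, ← dz_succ', ← mul_assoc]
    rw [ih, add_mul, smul_mul_assoc, mul_assoc, h1, mul_assoc, h2, mul_add, mul_smul_comm, mul_smul_comm,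
      ← mul_assoc, ← mul_assoc, dz_succ', dz_succ', smul_mul_assoc, smul_mul_assoc]
    have e2 : (n : ℤ) - 1 + 1 = n := by ring
    have e3 : (n : ℤ) + 1 - 1 = n := by ring
    rw [e2, e3]
    have e4 : qz ((n : ℤ) + 1) = qq ^ (n : ℤ) + qq⁻¹ * qz n := by
      rw [add_comm, qz_add, qz_one, mul_one, zpow_neg_one]
    have e5 : qq ^ ((n : ℤ) + 1) = qq ^ (n : ℤ) * qq := zpow_add_one₀ h0 _
    rw [e5]
    simp only [smul_add, smul_smul]
    have c : qq ^ (n : ℤ) * (qq * qz ((n : ℤ) + 1)) = qz ((n : ℤ) + 1) * (qq ^ (n : ℤ) * qq) := by ring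
    rw [c, add_right_comm, ← add_smul, ← e4, add_comm]

theorem y_dz_z {y z : A} (h : y * z = qq⁻¹ • (z * y)) (k : ℤ) :
    y * dz z k = qq ^ (-k) • (dz z k * y) := by
  have h0 := qq_ne
  rcases lt_or_ge k 0 with hk | hk
  · simp [dz_neg z k hk]
  obtain ⟨n, rfl⟩ := Int.eq_ofNat_of_zero_le hk
  have : y * z ^ n = (qq⁻¹) ^ n • (z ^ n * y) := by
    clear hk
    induction n with
    | zero => simp
    | succ n ih =>
      rw [pow_succ, ← mul_assoc, ih, smul_mul_assoc, mul_assoc, h, mul_smul_comm, smul_smul, ← mul_assoc,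
        pow_succ]
  rw [dz_nat, dq, mul_smul_comm, this, smul_mul_assoc, smul_comm]
  congr 1
  rw [zpow_neg, zpow_natCast, inv_pow]

theorem dq_y_dz_x {x y z : A} (h1 : y * x = z + qq • (x * y)) (h2 : z * x = qq⁻¹ • (x * z))
    (h3 : y * z = qq⁻¹ • (z * y)) (m : ℤ) (n : ℕ) :
    dz y n * dz x m = ∑ j ∈ Finset.range (n + 1),
      qq ^ ((m - j) * ((n : ℤ) - j)) • (dz x (m - j) * dz z j * dz y ((n : ℤ) - j)) := by
  have h0 := qq_ne
  induction n with
  | zero => simp [dz, dq_zero]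
  | succ n ih =>
    refine smul_cancel (qz_ne n) ?_
    have e : (((n + 1 : ℕ) : ℤ)) = (n : ℤ) + 1 := by push_cast; rfl
    rw [e, ← smul_mul_assoc, ← dz_succ, mul_assoc, ih, Finset.mul_sum]
    set t : ℤ → A := fun j => dz x (m - j) * dz z j * dz y ((n : ℤ) + 1 - j) with ht
    set c1 : ℤ → 𝕂 := fun j => qq ^ ((m - j) * ((n : ℤ) - j) + (m - j) - j) * qz ((n : ℤ) + 1 - j)
    set c2 : ℤ → 𝕂 := fun j => qq ^ ((m - j + 1) * ((n : ℤ) + 1 - j)) * qz j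
    have hL : ∀ j : ℤ, y * qq ^ ((m - j) * ((n : ℤ) - j)) • (dz x (m - j) * dz z j * dz y ((n : ℤ) - j))
        = c1 j • t j + c2 (j + 1) • t (j + 1) := by
      intro j
      rw [mul_smul_comm, ← mul_assoc, ← mul_assoc, y_dz_x h1 h2, add_mul, smul_mul_assoc, mul_assoc _ y,
        y_dz_z h3, mul_smul_comm, mul_assoc _ z, dz_succ, mul_smul_comm, add_mul, smul_mul_assoc,
        smul_mul_assoc, smul_mul_assoc, ← mul_assoc, mul_assoc _ y, dz_succ, mul_smul_comm]
      have e1 : (n : ℤ) - j + 1 = n + 1 - j := by ring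
      have e2 : m - j - 1 = m - (j + 1) := by ring
      have e3 : (n : ℤ) - j = n + 1 - (j + 1) := by ring
      rw [smul_add]
      simp only [smul_smul, t, c1, c2, e1, e2]
      congr 1
      · congr 1
        rw [← mul_assoc, ← mul_assoc, ← zpow_add₀ h0, ← zpow_add₀ h0]
        congr 2
      · rw [e3]
        congr 3; ring
    simp only [hL]
    rw [Finset.sum_add_distrib]
    have hA : ∑ j ∈ Finset.range (n + 1), c1 j • t j = ∑ j ∈ Finset.range (n + 1 + 1), c1 j • t j := by
      rw [Finset.sum_range_succ _ (n + 1)]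
      have : c1 ((n + 1 : ℕ) : ℤ) = 0 := by simp [c1, qz_zero]
      rw [this, zero_smul, add_zero]
    have hB : ∑ j ∈ Finset.range (n + 1), c2 ((j : ℤ) + 1) • t ((j : ℤ) + 1)
        = ∑ j ∈ Finset.range (n + 1 + 1), c2 j • t j := by
      rw [Finset.sum_range_succ' _ (n + 1)]
      have : c2 ((0 : ℕ) : ℤ) = 0 := by simp [c2, qz_zero]
      rw [this, zero_smul, add_zero]
      push_cast; rfl
    rw [hA, hB, ← Finset.sum_add_distrib, Finset.smul_sum]
    refine Finset.sum_congr rfl fun j _ => ?_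
    rw [← add_smul, smul_smul]
    congr 1
    have : qz ((n : ℤ) + 1) = qq ^ ((n : ℤ) + 1 - j) * qz j + qq ^ (-(j : ℤ)) * qz ((n : ℤ) + 1 - j) := by
      rw [← qz_add]; congr 1; ring
    rw [this]
    simp only [c1, c2]
    have e1 : (m - (j : ℤ)) * ((n : ℤ) - j) + (m - j) - j = -(j : ℤ) + (m - j) * ((n : ℤ) + 1 - j) := by ring
    have e2 : (m - (j : ℤ) + 1) * ((n : ℤ) + 1 - j) = ((n : ℤ) + 1 - j) + (m - j) * ((n : ℤ) + 1 - j) := by ring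
    rw [e1, e2, zpow_add₀ h0, zpow_add₀ h0]
    ring

theorem dq_yx {x y z : A} (h1 : y * x = z + qq • (x * y)) (h2 : z * x = qq⁻¹ • (x * z))
    (h3 : y * z = qq⁻¹ • (z * y)) (m n N : ℕ) (hN : N ≤ n) (hNm : min m n ≤ N) :
    dq y n * dq x m = ∑ j ∈ Finset.range (N + 1),
      qq ^ (((m : ℤ) - j) * ((n : ℤ) - j)) • (dz x ((m : ℤ) - j) * dq z j * dz y ((n : ℤ) - j)) := by
  rw [← dz_nat, ← dz_nat, dq_y_dz_x h1 h2 h3]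
  symm
  simp only [dz_nat]
  refine Finset.sum_subset (Finset.range_subset_range.mpr (by omega)) ?_
  intro j hj hj'
  simp only [Finset.mem_range] at hj hj'
  rw [dz_neg x _ (by omega)]
  simp

theorem triang1 {x y z : A} (h1 : y * x = z + qq • (x * y)) (h2 : z * x = qq⁻¹ • (x * z))
    (h3 : y * z = qq⁻¹ • (z * y)) (a b c : ℕ) (h : a + c ≤ b) :
    ∃ κ : ℕ → 𝕂, (∀ j ∈ Finset.range c, κ j ∈ PP) ∧ dq x a * dq y b * dq x c =
      (∑ j ∈ Finset.range c, κ j • (dq x (a + (c - j)) * dq z j * dq y (b - j)))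
        + dq x a * dq z c * dq y (b - c) := by
  refine ⟨fun j => qq ^ (((c : ℤ) - j) * ((b : ℤ) - j)) * Gb a (c - j), ?_, ?_⟩
  · intro j hj
    have hj := Finset.mem_range.mp hj
    apply Gb_mem'
    rw [Nat.cast_sub hj.le, mul_comm]
    exact mul_le_mul_of_nonneg_left (by omega) (by omega)
  · rw [mul_assoc, dq_yx h1 h2 h3 c b c (by omega) (by omega), Finset.sum_range_succ, mul_add, Finset.mul_sum]
    have key : ∀ j, j ≤ c → dq x a * qq ^ (((c : ℤ) - j) * ((b : ℤ) - j)) •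
        (dz x ((c : ℤ) - j) * dq z j * dz y ((b : ℤ) - j)) =
        (qq ^ (((c : ℤ) - j) * ((b : ℤ) - j)) * Gb a (c - j)) •
          (dq x (a + (c - j)) * dq z j * dq y (b - j)) := by
      intro j hj
      rw [← Nat.cast_sub hj, ← Nat.cast_sub (show j ≤ b by omega), dz_nat, dz_nat, mul_smul_comm,
        ← mul_assoc, ← mul_assoc, dq_mul, smul_mul_assoc, smul_mul_assoc, smul_smul]
    congr 1
    · exact Finset.sum_congr rfl fun j hj => key j (Finset.mem_range.mp hj).le
    · rw [key c le_rfl]; simp [Gb_zero_right]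

theorem triang2 {x y z : A} (h1 : y * x = z + qq • (x * y)) (h2 : z * x = qq⁻¹ • (x * z))
    (h3 : y * z = qq⁻¹ • (z * y)) (a b c : ℕ) (h : a + c ≤ b) :
    ∃ κ : ℕ → 𝕂, (∀ j ∈ Finset.range a, κ j ∈ PP) ∧ dq y a * dq x b * dq y c =
      (∑ j ∈ Finset.range a, κ j • (dq x (b - j) * dq z j * dq y ((a - j) + c)))
        + dq x (b - a) * dq z a * dq y c := by
  refine ⟨fun j => qq ^ (((b : ℤ) - j) * ((a : ℤ) - j)) * Gb (a - j) c, ?_, ?_⟩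
  · intro j hj
    have hj := Finset.mem_range.mp hj
    apply Gb_mem'
    rw [Nat.cast_sub hj.le, mul_comm]
    exact mul_le_mul_of_nonneg_right (by omega) (by omega)
  · rw [dq_yx h1 h2 h3 b a a (by omega) (by omega), Finset.sum_range_succ, add_mul, Finset.sum_mul]
    have key : ∀ j, j ≤ a → (qq ^ (((b : ℤ) - j) * ((a : ℤ) - j)) •
        (dz x ((b : ℤ) - j) * dq z j * dz y ((a : ℤ) - j))) * dq y c =
        (qq ^ (((b : ℤ) - j) * ((a : ℤ) - j)) * Gb (a - j) c) •
          (dq x (b - j) * dq z j * dq y ((a - j) + c)) := by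
      intro j hj
      rw [← Nat.cast_sub hj, ← Nat.cast_sub (show j ≤ b by omega), dz_nat, dz_nat, smul_mul_assoc,
        mul_assoc, dq_mul, mul_smul_comm, smul_smul]
    congr 1
    · exact Finset.sum_congr rfl fun j hj => key j (Finset.mem_range.mp hj).le
    · rw [key a le_rfl]; simp [Gb_zero_left]

theorem serre_zx_aux {k : Type*} [Field k] {A : Type*} [Ring A] [Algebra k A] {q : k} (h0 : q ≠ 0)
    {x y : A} (s : x ^ 2 * y + y * x ^ 2 = (q + q⁻¹) • (x * y * x)) :
    (y * x - q • (x * y)) * x = q⁻¹ • (x * (y * x - q • (x * y))) := by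
  have s' : y * x ^ 2 = (q + q⁻¹) • (x * y * x) - x ^ 2 * y := by rw [← s]; abel
  rw [sub_mul, mul_assoc, ← sq, s', mul_sub, smul_sub, smul_mul_assoc, mul_smul_comm, smul_smul,
    inv_mul_cancel₀ h0, one_smul, sq, mul_assoc x x y, mul_assoc x y x]
  module

theorem serre_yz_aux {k : Type*} [Field k] {A : Type*} [Ring A] [Algebra k A] {q : k} (h0 : q ≠ 0)
    {x y : A} (s : y ^ 2 * x + x * y ^ 2 = (q + q⁻¹) • (y * x * y)) :
    y * (y * x - q • (x * y)) = q⁻¹ • ((y * x - q • (x * y)) * y) := by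
  have s' : y ^ 2 * x = (q + q⁻¹) • (y * x * y) - x * y ^ 2 := by rw [← s]; abel
  rw [mul_sub, ← mul_assoc, ← sq, s', sub_mul, smul_sub, smul_mul_assoc, mul_smul_comm, smul_smul,
    inv_mul_cancel₀ h0, one_smul, sq, mul_assoc x y y, mul_assoc y x y]
  module

theorem serre_zx {x y : A} (s : x ^ 2 * y + y * x ^ 2 = (qq + qq⁻¹) • (x * y * x)) :
    (y * x - qq • (x * y)) * x = qq⁻¹ • (x * (y * x - qq • (x * y))) := serre_zx_aux qq_ne s

theorem serre_yz {x y : A} (s : y ^ 2 * x + x * y ^ 2 = (qq + qq⁻¹) • (y * x * y)) :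
    y * (y * x - qq • (x * y)) = qq⁻¹ • ((y * x - qq • (x * y)) * y) := serre_yz_aux qq_ne s

variable [Module ℤ[X] A] [IsScalarTower ℤ[X] 𝕂 A]

def CS (x y : A) : Set A :=
  {t | ∃ a b c : ℕ, a + c ≤ b ∧ t = dq x a * dq y b * dq x c}

theorem PP_smul_mem {M : Submodule ℤ[X] A} {c : 𝕂} (hc : c ∈ PP) {t : A} (ht : t ∈ M) : c • t ∈ M := by
  obtain ⟨p, rfl⟩ := hc
  rw [algebraMap_smul]
  exact M.smul_mem p ht

theorem span_eq_CS {x y z : A} (h1 : y * x = z + qq • (x * y)) (h2 : z * x = qq⁻¹ • (x * z))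
    (h3 : y * z = qq⁻¹ • (z * y)) :
    Submodule.span ℤ[X] {t : A | ∃ a b c : ℕ, t = dq x a * dq z b * dq y c}
      = Submodule.span ℤ[X] (CS x y ∪ CS y x) := by
  apply le_antisymm
  · rw [Submodule.span_le]
    rintro _ ⟨a, b, c, rfl⟩
    rw [SetLike.mem_coe]
    induction b using Nat.strong_induction_on generalizing a c with
    | _ b ih =>
      rcases le_total a c with hac | hac
      · obtain ⟨κ, hκ, e⟩ := triang1 h1 h2 h3 a (b + c) b (by omega)
        have e2 : b + c - b = c := by omega
        rw [e2] at e
        rw [eq_sub_iff_add_eq'.mpr e.symm]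
        refine Submodule.sub_mem _ (Submodule.subset_span (Or.inl ⟨a, b + c, b, by omega, rfl⟩)) ?_
        exact Submodule.sum_mem _ fun j hj => PP_smul_mem (hκ j hj) (ih j (Finset.mem_range.mp hj) _ _)
      · obtain ⟨κ, hκ, e⟩ := triang2 h1 h2 h3 b (a + b) c (by omega)
        have e2 : a + b - b = a := by omega
        rw [e2] at e
        rw [eq_sub_iff_add_eq'.mpr e.symm]
        refine Submodule.sub_mem _ (Submodule.subset_span (Or.inr ⟨b, a + b, c, by omega, rfl⟩)) ?_
        exact Submodule.sum_mem _ fun j hj => PP_smul_mem (hκ j hj) (ih j (Finset.mem_range.mp hj) _ _)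
  · rw [Submodule.span_le]
    rintro _ (⟨a, b, c, h, rfl⟩ | ⟨a, b, c, h, rfl⟩)
    · obtain ⟨κ, hκ, e⟩ := triang1 h1 h2 h3 a b c h
      rw [e, SetLike.mem_coe]
      refine Submodule.add_mem _ ?_ (Submodule.subset_span ⟨_, _, _, rfl⟩)
      exact Submodule.sum_mem _ fun j hj => PP_smul_mem (hκ j hj) (Submodule.subset_span ⟨_, _, _, rfl⟩)
    · obtain ⟨κ, hκ, e⟩ := triang2 h1 h2 h3 a b c h
      rw [e, SetLike.mem_coe]
      refine Submodule.add_mem _ ?_ (Submodule.subset_span ⟨_, _, _, rfl⟩)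
      exact Submodule.sum_mem _ fun j hj => PP_smul_mem (hκ j hj) (Submodule.subset_span ⟨_, _, _, rfl⟩)

theorem rank2 {x y : A} (s : x ^ 2 * y + y * x ^ 2 = (qq + qq⁻¹) • (x * y * x))
    (s' : y ^ 2 * x + x * y ^ 2 = (qq + qq⁻¹) • (y * x * y)) :
    Submodule.span ℤ[X] {t : A | ∃ a b c : ℕ, t = dq x a * dq (y * x - qq • (x * y)) b * dq y c} =
    Submodule.span ℤ[X] {t : A | ∃ a b c : ℕ, t = dq y a * dq (x * y - qq • (y * x)) b * dq x c} := by
  rw [span_eq_CS (by abel) (serre_zx s) (serre_yz s'), span_eq_CS (by abel) (serre_zx s') (serre_yz s),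
    Set.union_comm]

end PartB

section PartC0
variable {k : Type*} [Field k] {A : Type*} [Ring A] [Algebra k A]

theorem inv_uniq {x y y' : A} (h : x * y = 1) (h' : y' * x = 1) : y = y' := by
  calc y = y' * x * y := by rw [h', one_mul]
    _ = y' := by rw [mul_assoc, h, mul_one]

theorem conj_move {K K' X : A} {c : k} (h : K' * K = 1) (h2 : K * X * K' = c • X) :
    K * X = c • (X * K) := by
  rw [← smul_mul_assoc, ← h2, mul_assoc, h, mul_one]

theorem conj_move' {K K' X : A} {c : k} (hc : c ≠ 0) (h : K' * K = 1) (h2 : K * X * K' = c • X) :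
    K' * X = c⁻¹ • (X * K') := by
  have h3 : X * K' = c • (K' * X) := by
    rw [← mul_smul_comm, ← h2, ← mul_assoc, ← mul_assoc, h, one_mul]
  rw [h3, smul_smul, inv_mul_cancel₀ hc, one_smul]

theorem rel_assoc {x y r : A} (h : x * y = r) (t : A) : x * (y * t) = r * t := by
  rw [← mul_assoc, h]

theorem braidE_aux {q : k} (h0 : q ≠ 0) (h1 : q - q⁻¹ ≠ 0) {K K' E F e : A}
    (kk : K * K' = 1) (k'k : K' * K = 1)
    (kE : K * E * K' = q ^ 2 • E) (ke : K * e * K' = q⁻¹ • e)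
    (EF : E * F - F * E = (q - q⁻¹)⁻¹ • (K - K')) (eF : e * F = F * e) :
    (E * e - q⁻¹ • (e * E)) * (-(F * K)) - q⁻¹ • (-(F * K) * (E * e - q⁻¹ • (e * E))) = e := by
  have r1 := conj_move k'k kE
  have r2 := conj_move k'k ke
  have r3 := conj_move' (inv_ne_zero h0) k'k ke
  have r4 : E * F = F * E + (q - q⁻¹)⁻¹ • (K - K') := by rw [← EF]; abel
  have r1' := rel_assoc r1
  have r2' := rel_assoc r2
  have r3' := rel_assoc r3
  have r4' := rel_assoc r4
  have r5' := rel_assoc eF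
  simp only [mul_add, add_mul, mul_sub, sub_mul, neg_mul, mul_neg, smul_mul_assoc, mul_smul_comm,
    mul_assoc, r1, r2, r3, r4, r1', r2', r3', r4', r5', eF, smul_add, smul_sub, smul_neg, smul_smul, kk, k'k,
    mul_one, one_mul, neg_add, neg_sub]
  have h2 : q ^ 2 - 1 ≠ 0 := by
    intro h
    apply h1
    field_simp
    linear_combination h
  match_scalars <;> field_simp <;> ring

theorem braidF_aux {q : k} (h0 : q ≠ 0) (h1 : q - q⁻¹ ≠ 0) {K K' E F f : A}
    (kk : K * K' = 1) (k'k : K' * K = 1)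
    (kF : K * F * K' = (q ^ 2)⁻¹ • F) (kf : K * f * K' = q • f) (kE : K * E * K' = q ^ 2 • E)
    (EF : E * F - F * E = (q - q⁻¹)⁻¹ • (K - K')) (Ef : E * f = f * E) :
    (-(K' * E)) * (f * F - q • (F * f)) - q • ((f * F - q • (F * f)) * (-(K' * E))) = f := by
  have r1 := conj_move' (inv_ne_zero (pow_ne_zero 2 h0)) k'k kF
  have r2 := conj_move' h0 k'k kf
  have r3 := conj_move k'k kf
  have r5 := conj_move' (pow_ne_zero 2 h0) k'k kE
  have r4 : E * F = F * E + (q - q⁻¹)⁻¹ • (K - K') := by rw [← EF]; abel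
  have r1' := rel_assoc r1
  have r2' := rel_assoc r2
  have r3' := rel_assoc r3
  have r4' := rel_assoc r4
  have r5' := rel_assoc Ef
  have r6' := rel_assoc r5
  have r7' := rel_assoc kk
  have r8' := rel_assoc k'k
  simp only [mul_add, add_mul, mul_sub, sub_mul, neg_mul, mul_neg, smul_mul_assoc, mul_smul_comm,
    mul_assoc, r1, r2, r3, r4, r5, r1', r2', r3', r4', r5', r6', r7', r8', Ef, smul_add, smul_sub, smul_neg,
    smul_smul, kk, k'k, mul_one, one_mul, neg_add, neg_sub]
  have h2 : q ^ 2 - 1 ≠ 0 := by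
    intro h
    apply h1
    field_simp
    linear_combination h
  match_scalars <;> field_simp <;> ring

theorem mixF_aux {q : k} {x y z : A} (h : z * y = y * z) :
    (z * x - q • (x * z)) * y - q • (y * (z * x - q • (x * z))) =
    z * (x * y - q • (y * x)) - q • ((x * y - q • (y * x)) * z) := by
  have h' := rel_assoc h
  simp only [mul_sub, sub_mul, smul_mul_assoc, mul_smul_comm, mul_assoc, h, h', smul_sub, smul_smul]
  module

theorem mixE_aux {q : k} {x y z : A} (h : z * y = y * z) :
    y * (x * z - q • (z * x)) - q • ((x * z - q • (z * x)) * y) =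
    (y * x - q • (x * y)) * z - q • (z * (y * x - q • (x * y))) := by
  have h' := rel_assoc h
  simp only [mul_sub, sub_mul, smul_mul_assoc, mul_smul_comm, mul_assoc, h, h', smul_sub, smul_smul]
  module

theorem farF_aux {q : k} {x y z : A} (h : x * y = y * x) :
    (z * x - q • (x * z)) * y - q • (y * (z * x - q • (x * z))) =
    (z * y - q • (y * z)) * x - q • (x * (z * y - q • (y * z))) := by
  have h' := rel_assoc h
  simp only [mul_sub, sub_mul, smul_mul_assoc, mul_smul_comm, mul_assoc, h, h', smul_sub, smul_smul]
  module

theorem farE_aux {q : k} {x y z : A} (h : x * y = y * x) :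
    y * (x * z - q • (z * x)) - q • ((x * z - q • (z * x)) * y) =
    x * (y * z - q • (z * y)) - q • ((y * z - q • (z * y)) * x) := by
  have h' := rel_assoc h
  simp only [mul_sub, sub_mul, smul_mul_assoc, mul_smul_comm, mul_assoc, h, h', smul_sub, smul_smul]
  module

end PartC0

section PartC
variable {I : Type} [Fintype I] [DecidableEq I] {D : ADEData I}

theorem uq_ext (f g : Uq D →ₐ[𝕂] Uq D) (hE : ∀ i, f (EE D i) = g (EE D i))
    (hF : ∀ i, f (FF D i) = g (FF D i)) (hK : ∀ i, f (KK D i) = g (KK D i)) : f = g := by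
  apply RingQuot.ringQuot_ext'
  apply FreeAlgebra.hom_ext
  funext t
  have kk : ∀ i, KK D i * KKinv D i = 1 := fun i => by
    simpa [KK, KKinv] using RingQuot.mkAlgHom_rel 𝕂 (QRel.KKinv (D := D) i)
  have k'k : ∀ i, KKinv D i * KK D i = 1 := fun i => by
    simpa [KK, KKinv] using RingQuot.mkAlgHom_rel 𝕂 (QRel.KinvK (D := D) i)
  cases t with
  | E i => exact hE i
  | F i => exact hF i
  | K i => exact hK i
  | Kinv i =>
    change f (KKinv D i) = g (KKinv D i)
    refine inv_uniq (x := f (KK D i)) ?_ ?_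
    · rw [← map_mul, kk, map_one]
    · rw [hK, ← map_mul, k'k, map_one]

variable (D)
theorem rkk (i : I) : KK D i * KKinv D i = 1 := by
  simpa [KK, KKinv] using RingQuot.mkAlgHom_rel 𝕂 (QRel.KKinv (D := D) i)
theorem rk'k (i : I) : KKinv D i * KK D i = 1 := by
  simpa [KK, KKinv] using RingQuot.mkAlgHom_rel 𝕂 (QRel.KinvK (D := D) i)
theorem rkcomm (i j : I) : KK D i * KK D j = KK D j * KK D i := by
  simpa only [EE, FF, KK, KKinv, map_mul] using RingQuot.mkAlgHom_rel 𝕂 (QRel.KcommK (D := D) i j)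
theorem rKE (i : I) : KK D i * EE D i * KKinv D i = (qq ^ 2) • EE D i := by
  simpa only [EE, FF, KK, KKinv, map_mul, map_smul] using RingQuot.mkAlgHom_rel 𝕂 (QRel.KEself (D := D) i)
theorem rKF (i : I) : KK D i * FF D i * KKinv D i = (qq ^ 2)⁻¹ • FF D i := by
  simpa only [EE, FF, KK, KKinv, map_mul, map_smul] using RingQuot.mkAlgHom_rel 𝕂 (QRel.KFself (D := D) i)
theorem rEF (i : I) : EE D i * FF D i - FF D i * EE D i = (qq - qq⁻¹)⁻¹ • (KK D i - KKinv D i) := by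
  simpa only [EE, FF, KK, KKinv, map_mul, map_smul, map_sub] using RingQuot.mkAlgHom_rel 𝕂 (QRel.EFself (D := D) i)
theorem rEFd (i j : I) (h : i ≠ j) : EE D i * FF D j = FF D j * EE D i := by
  rw [← sub_eq_zero]
  simpa only [EE, FF, KK, KKinv, map_mul, map_zero, map_sub] using RingQuot.mkAlgHom_rel 𝕂 (QRel.EFdiff (D := D) i j h)
theorem rserre (i j : I) (h : D.adj i j = true) : FF D i ^ 2 * FF D j + FF D j * FF D i ^ 2
    = (qq + qq⁻¹) • (FF D i * FF D j * FF D i) := by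
  simpa only [EE, FF, KK, KKinv, map_mul, map_smul, map_add, map_pow] using
    RingQuot.mkAlgHom_rel 𝕂 (QRel.serreF (D := D) i j h)
theorem rKEadj (i j : I) (h : D.adj i j = true) : KK D i * EE D j * KKinv D i = qq⁻¹ • EE D j := by
  simpa only [EE, FF, KK, KKinv, map_mul, map_smul] using RingQuot.mkAlgHom_rel 𝕂 (QRel.KEadj (D := D) i j h)
theorem rKFadj (i j : I) (h : D.adj i j = true) : KK D i * FF D j * KKinv D i = qq • FF D j := by
  simpa only [EE, FF, KK, KKinv, map_mul, map_smul] using RingQuot.mkAlgHom_rel 𝕂 (QRel.KFadj (D := D) i j h)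
theorem rEE (i j : I) (h : i ≠ j) (h' : D.adj i j = false) : EE D i * EE D j = EE D j * EE D i := by
  simpa only [EE, FF, KK, KKinv, map_mul] using RingQuot.mkAlgHom_rel 𝕂 (QRel.EEfar (D := D) i j h h')
theorem rFF (i j : I) (h : i ≠ j) (h' : D.adj i j = false) : FF D i * FF D j = FF D j * FF D i := by
  simpa only [EE, FF, KK, KKinv, map_mul] using RingQuot.mkAlgHom_rel 𝕂 (QRel.FFfar (D := D) i j h h')

theorem no_triangle {a b c : I} (h1 : D.adj a b = true) (h2 : D.adj b c = true)
    (h3 : D.adj a c = true) : False := by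
  have h := Bf_pos D (simpleRoot a + simpleRoot b + simpleRoot c) (by
    intro h
    have := congrFun h a
    simp [simpleRoot, ne_of_adj D h1, ne_of_adj D h3] at this)
  simp only [Bf_add_left, Bf_add_right, Bf_simple_self, Bf_simple_adj D h1, Bf_simple_adj D h2,
    Bf_simple_adj D h3, Bf_simple_adj D (adj_symm D h1), Bf_simple_adj D (adj_symm D h2),
    Bf_simple_adj D (adj_symm D h3)] at h
  norm_num at h

variable {D} {T : I → (Uq D ≃ₐ[𝕂] Uq D)} (hT : IsLusztigAuts D T)
include hT

theorem tFs (i : I) : T i (FF D i) = -(KKinv D i * EE D i) := (hT i i).1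
theorem tFa {i j : I} (h : D.adj i j = true) :
    T i (FF D j) = FF D j * FF D i - qq • (FF D i * FF D j) := (hT i j).2.1 h
theorem tFf {i j : I} (h : i ≠ j) (h' : D.adj i j = false) : T i (FF D j) = FF D j := (hT i j).2.2.1 h h'
theorem tEs (i : I) : T i (EE D i) = -(FF D i * KK D i) := (hT i i).2.2.2.1
theorem tEa {i j : I} (h : D.adj i j = true) :
    T i (EE D j) = EE D i * EE D j - qq⁻¹ • (EE D j * EE D i) := (hT i j).2.2.2.2.1 h
theorem tEf {i j : I} (h : i ≠ j) (h' : D.adj i j = false) : T i (EE D j) = EE D j :=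
  (hT i j).2.2.2.2.2.1 h h'
theorem tKs (i : I) : T i (KK D i) = KKinv D i := (hT i i).2.2.2.2.2.2.1
theorem tKa {i j : I} (h : D.adj i j = true) : T i (KK D j) = KK D i * KK D j :=
  (hT i j).2.2.2.2.2.2.2.1 h
theorem tKf {i j : I} (h : i ≠ j) (h' : D.adj i j = false) : T i (KK D j) = KK D j :=
  (hT i j).2.2.2.2.2.2.2.2 h h'

theorem ttK {a b : I} (h : D.adj a b = true) : T a (T b (KK D a)) = KK D b := by
  rw [tKa hT (adj_symm D h), map_mul, tKa hT h, tKs hT, rkcomm D a b, mul_assoc, rkk, mul_one]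

theorem ttF {a b : I} (h : D.adj a b = true) : T a (T b (FF D a)) = FF D b := by
  rw [tFa hT (adj_symm D h), map_sub, map_smul, map_mul, map_mul, tFs hT, tFa hT h]
  exact braidF_aux qq_ne qq_sub_ne (rkk D a) (rk'k D a) (rKF D a) (rKFadj D a b h) (rKE D a) (rEF D a)
    (rEFd D a b (ne_of_adj D h))

theorem ttE {a b : I} (h : D.adj a b = true) : T a (T b (EE D a)) = EE D b := by
  rw [tEa hT (adj_symm D h), map_sub, map_smul, map_mul, map_mul, tEs hT, tEa hT h]
  exact braidE_aux qq_ne qq_sub_ne (rkk D a) (rk'k D a) (rKE D a) (rKEadj D a b h) (rEF D a)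
    (rEFd D b a (ne_of_adj D h).symm)

theorem ttK' {a b : I} (h : D.adj a b = true) : T a (T b (KKinv D a)) = KKinv D b := by
  refine inv_uniq (x := KK D b) ?_ (rk'k D b)
  rw [← ttK hT h, ← map_mul, ← map_mul, rkk, map_one, map_one]

theorem tKf' {i j : I} (h : i ≠ j) (h' : D.adj i j = false) : T i (KKinv D j) = KKinv D j := by
  refine inv_uniq (x := KK D j) ?_ (rk'k D j)
  nth_rewrite 1 [← tKf hT h h']
  rw [← map_mul, rkk, map_one]

theorem braid_self {a b : I} (h : D.adj a b = true) :
    (T a (T b (T a (EE D a))) = T b (T a (T b (EE D a)))) ∧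
    (T a (T b (T a (FF D a))) = T b (T a (T b (FF D a)))) ∧
    (T a (T b (T a (KK D a))) = T b (T a (T b (KK D a)))) := by
  refine ⟨?_, ?_, ?_⟩
  · rw [ttE hT h, tEs hT, tEs hT, map_neg, map_neg, map_mul, map_mul, ttF hT h, ttK hT h]
  · rw [ttF hT h, tFs hT, tFs hT, map_neg, map_neg, map_mul, map_mul, ttE hT h, ttK' hT h]
  · rw [ttK hT h, tKs hT, tKs hT, ttK' hT h]

theorem braid_adj {a b c : I} (h : D.adj a b = true) (hc : D.adj a c = true) (hbc : b ≠ c)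
    (hf : D.adj b c = false) :
    (T a (T b (T a (EE D c))) = T b (T a (T b (EE D c)))) ∧
    (T a (T b (T a (FF D c))) = T b (T a (T b (FF D c)))) ∧
    (T a (T b (T a (KK D c))) = T b (T a (T b (KK D c)))) := by
  refine ⟨?_, ?_, ?_⟩
  · rw [tEf hT hbc hf, tEa hT hc]
    simp only [map_sub, map_smul, map_mul]
    rw [ttE hT h, tEf hT hbc hf, tEa hT hc, tEa hT (adj_symm D h)]
    exact mixE_aux (rEE D b c hbc hf).symm
  · rw [tFf hT hbc hf, tFa hT hc]
    simp only [map_sub, map_smul, map_mul]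
    rw [ttF hT h, tFf hT hbc hf, tFa hT hc, tFa hT (adj_symm D h)]
    exact mixF_aux (rFF D b c hbc hf).symm
  · rw [tKf hT hbc hf, tKa hT hc]
    simp only [map_mul]
    rw [ttK hT h, tKf hT hbc hf, tKa hT hc, tKa hT (adj_symm D h), mul_assoc]

theorem braid_all {a b : I} (h : D.adj a b = true) (c : I) :
    (T a (T b (T a (EE D c))) = T b (T a (T b (EE D c)))) ∧
    (T a (T b (T a (FF D c))) = T b (T a (T b (FF D c)))) ∧
    (T a (T b (T a (KK D c))) = T b (T a (T b (KK D c)))) := by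
  have h' := adj_symm D h
  by_cases hac : a = c
  · subst hac; exact braid_self hT h
  by_cases hbc : b = c
  · subst hbc
    obtain ⟨h1, h2, h3⟩ := braid_self hT h'
    exact ⟨h1.symm, h2.symm, h3.symm⟩
  cases ha : D.adj a c with
  | true =>
    cases hb : D.adj b c with
    | true => exact (no_triangle D h hb ha).elim
    | false => exact braid_adj hT h ha hbc hb
  | false =>
    cases hb : D.adj b c with
    | true =>
      obtain ⟨h1, h2, h3⟩ := braid_adj hT h' hb hac ha
      exact ⟨h1.symm, h2.symm, h3.symm⟩
    | false =>
      simp only [tEf hT hac ha, tEf hT hbc hb, tFf hT hac ha, tFf hT hbc hb, tKf hT hac ha,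
        tKf hT hbc hb, and_self]

theorem braid_rel {a b : I} (h : D.adj a b = true) (x : Uq D) :
    T a (T b (T a x)) = T b (T a (T b x)) := by
  have := uq_ext (D := D)
    (((T a : Uq D →ₐ[𝕂] Uq D).comp (T b : Uq D →ₐ[𝕂] Uq D)).comp (T a : Uq D →ₐ[𝕂] Uq D))
    (((T b : Uq D →ₐ[𝕂] Uq D).comp (T a : Uq D →ₐ[𝕂] Uq D)).comp (T b : Uq D →ₐ[𝕂] Uq D))
    (fun c => (braid_all hT h c).1) (fun c => (braid_all hT h c).2.1) (fun c => (braid_all hT h c).2.2)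
  exact DFunLike.congr_fun this x

theorem far_self {a b : I} (hab : a ≠ b) (h : D.adj a b = false) :
    (T a (T b (EE D a)) = T b (T a (EE D a))) ∧
    (T a (T b (FF D a)) = T b (T a (FF D a))) ∧
    (T a (T b (KK D a)) = T b (T a (KK D a))) := by
  have h' := far_symm D h
  have hba := hab.symm
  refine ⟨?_, ?_, ?_⟩
  · rw [tEf hT hba h', tEs hT, map_neg, map_mul, tFf hT hba h', tKf hT hba h']
  · rw [tFf hT hba h', tFs hT, map_neg, map_mul, tEf hT hba h', tKf' hT hba h']
  · rw [tKf hT hba h', tKs hT, tKf' hT hba h']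

theorem far_adj {a b c : I} (hab : a ≠ b) (h : D.adj a b = false) (hc : D.adj a c = true)
    (hbc : b ≠ c) (hf : D.adj b c = false) :
    (T a (T b (EE D c)) = T b (T a (EE D c))) ∧
    (T a (T b (FF D c)) = T b (T a (FF D c))) ∧
    (T a (T b (KK D c)) = T b (T a (KK D c))) := by
  have h' := far_symm D h
  have hba := hab.symm
  refine ⟨?_, ?_, ?_⟩
  · rw [tEf hT hbc hf, tEa hT hc]
    simp only [map_sub, map_smul, map_mul, tEf hT hbc hf, tEf hT hba h']
  · rw [tFf hT hbc hf, tFa hT hc]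
    simp only [map_sub, map_smul, map_mul, tFf hT hbc hf, tFf hT hba h']
  · rw [tKf hT hbc hf, tKa hT hc]
    simp only [map_mul, tKf hT hbc hf, tKf hT hba h']

theorem far_all {a b : I} (hab : a ≠ b) (h : D.adj a b = false) (c : I) :
    (T a (T b (EE D c)) = T b (T a (EE D c))) ∧
    (T a (T b (FF D c)) = T b (T a (FF D c))) ∧
    (T a (T b (KK D c)) = T b (T a (KK D c))) := by
  have h' := far_symm D h
  have hba := hab.symm
  by_cases hac : a = c
  · subst hac; exact far_self hT hab h
  by_cases hbc : b = c
  · subst hbc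
    obtain ⟨h1, h2, h3⟩ := far_self hT hba h'
    exact ⟨h1.symm, h2.symm, h3.symm⟩
  cases ha : D.adj a c with
  | true =>
    cases hb : D.adj b c with
    | true =>
      refine ⟨?_, ?_, ?_⟩
      · rw [tEa hT ha, tEa hT hb]
        simp only [map_sub, map_smul, map_mul, tEf hT hba h', tEf hT hab h, tEa hT ha, tEa hT hb]
        exact farE_aux (rEE D a b hab h)
      · rw [tFa hT ha, tFa hT hb]
        simp only [map_sub, map_smul, map_mul, tFf hT hba h', tFf hT hab h, tFa hT ha, tFa hT hb]
        exact farF_aux (rFF D a b hab h)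
      · rw [tKa hT ha, tKa hT hb]
        simp only [map_mul, tKf hT hba h', tKf hT hab h, tKa hT ha, tKa hT hb]
        rw [← mul_assoc, ← mul_assoc, rkcomm D a b]
    | false => exact far_adj hT hab h ha hbc hb
  | false =>
    cases hb : D.adj b c with
    | true =>
      obtain ⟨h1, h2, h3⟩ := far_adj hT hba h' hb hac ha
      exact ⟨h1.symm, h2.symm, h3.symm⟩
    | false =>
      simp only [tEf hT hac ha, tEf hT hbc hb, tFf hT hac ha, tFf hT hbc hb, tKf hT hac ha,
        tKf hT hbc hb, and_self]

theorem far_rel {a b : I} (hab : a ≠ b) (h : D.adj a b = false) (x : Uq D) :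
    T a (T b x) = T b (T a x) := by
  have := uq_ext (D := D)
    ((T a : Uq D →ₐ[𝕂] Uq D).comp (T b : Uq D →ₐ[𝕂] Uq D))
    ((T b : Uq D →ₐ[𝕂] Uq D).comp (T a : Uq D →ₐ[𝕂] Uq D))
    (fun c => (far_all hT hab h c).1) (fun c => (far_all hT hab h c).2.1)
    (fun c => (far_all hT hab h c).2.2)
  exact DFunLike.congr_fun this x

end PartC

section PartD
open scoped Pointwise

theorem span_mul_le_aux {A : Type*} [Ring A] [Algebra 𝕂 A] [Module (Polynomial ℤ) A]
    (hs : ∀ (p : Polynomial ℤ) (x : A), p • x = algebraMap (Polynomial ℤ) 𝕂 p • x) {S S' U U' : Set A}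
    (h1 : Submodule.span (Polynomial ℤ) S ≤ Submodule.span (Polynomial ℤ) S')
    (h2 : Submodule.span (Polynomial ℤ) U ≤ Submodule.span (Polynomial ℤ) U') :
    Submodule.span (Polynomial ℤ) (S * U) ≤ Submodule.span (Polynomial ℤ) (S' * U') := by
  have key : ∀ x ∈ Submodule.span (Polynomial ℤ) S', ∀ y ∈ Submodule.span (Polynomial ℤ) U',
      x * y ∈ Submodule.span (Polynomial ℤ) (S' * U') := by
    intro x hx y hy
    induction hx using Submodule.span_induction with
    | mem s hs' =>
      induction hy using Submodule.span_induction with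
      | mem u hu => exact Submodule.subset_span (Set.mul_mem_mul hs' hu)
      | zero => rw [mul_zero]; exact Submodule.zero_mem _
      | add a b _ _ ha hb => rw [mul_add]; exact Submodule.add_mem _ ha hb
      | smul r a _ ha => rw [hs, mul_smul_comm, ← hs]; exact Submodule.smul_mem _ _ ha
    | zero => rw [zero_mul]; exact Submodule.zero_mem _
    | add a b _ _ ha hb => rw [add_mul]; exact Submodule.add_mem _ ha hb
    | smul r a _ ha => rw [hs, smul_mul_assoc, ← hs]; exact Submodule.smul_mem _ _ ha
  rw [Submodule.span_le]
  rintro _ ⟨s, hs, u, hu, rfl⟩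
  exact key _ (h1 (Submodule.subset_span hs)) _ (h2 (Submodule.subset_span hu))

theorem span_mul_congr {A : Type*} [Ring A] [Algebra 𝕂 A] [Module (Polynomial ℤ) A]
    (hs : ∀ (p : Polynomial ℤ) (x : A), p • x = algebraMap (Polynomial ℤ) 𝕂 p • x) {S S' U U' : Set A}
    (h1 : Submodule.span (Polynomial ℤ) S = Submodule.span (Polynomial ℤ) S')
    (h2 : Submodule.span (Polynomial ℤ) U = Submodule.span (Polynomial ℤ) U') :
    Submodule.span (Polynomial ℤ) (S * U) = Submodule.span (Polynomial ℤ) (S' * U') :=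
  le_antisymm (span_mul_le_aux hs h1.le h2.le) (span_mul_le_aux hs h1.ge h2.ge)

theorem span_image_congr_gen {A : Type*} [Ring A] [Algebra 𝕂 A] [Module (Polynomial ℤ) A]
    (hs : ∀ (p : Polynomial ℤ) (x : A), p • x = algebraMap (Polynomial ℤ) 𝕂 p • x)
    (f : A ≃ₐ[𝕂] A) {S S' : Set A}
    (h : Submodule.span (Polynomial ℤ) S = Submodule.span (Polynomial ℤ) S') :
    Submodule.span (Polynomial ℤ) (f '' S) = Submodule.span (Polynomial ℤ) (f '' S') := by
  let L : A →ₗ[Polynomial ℤ] A :=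
    { toFun := f
      map_add' := map_add f
      map_smul' := fun p x => by rw [hs, map_smul, ← hs, RingHom.id_apply] }
  have e : ∀ S : Set A, Submodule.span (Polynomial ℤ) (f '' S) =
      (Submodule.span (Polynomial ℤ) S).map L := fun S => (Submodule.map_span L S).symm
  rw [e, e, h]

theorem tower_gen {A : Type*} [Ring A] [Algebra 𝕂 A] [Module (Polynomial ℤ) A]
    (hs : ∀ (p : Polynomial ℤ) (x : A), p • x = algebraMap (Polynomial ℤ) 𝕂 p • x) :
    IsScalarTower (Polynomial ℤ) 𝕂 A :=
  ⟨fun p c u => by rw [hs, Algebra.smul_def p c, mul_smul]⟩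

variable {I : Type} [Fintype I] [DecidableEq I] {D : ADEData I}

/-- The set of divided powers. -/
def DP (x : Uq D) : Set (Uq D) := Set.range (dp x)

variable (T : I → (Uq D ≃ₐ[𝕂] Uq D))

theorem T_dp (i : I) (x : Uq D) (n : ℕ) : T i (dp x n) = dp (T i x) n := by
  simp only [dp, map_smul, map_pow]

theorem T_DP (i : I) (x : Uq D) : T i '' DP x = DP (T i x) := by
  ext t
  simp only [DP, Set.mem_image, Set.mem_range]
  constructor
  · rintro ⟨_, ⟨n, rfl⟩, rfl⟩
    exact ⟨n, (T_dp T i x n).symm⟩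
  · rintro ⟨n, rfl⟩
    exact ⟨_, ⟨n, rfl⟩, T_dp T i x n⟩

theorem pbw_cons (i : I) (l : List I) (a : Fin (i :: l).length → ℕ) :
    pbw T (i :: l) a = dp (FF D i) (a 0) * T i (pbw T l (fun k => a k.succ)) := by
  unfold pbw
  change ((List.finRange (l.length + 1)).map _).prod = _
  rw [List.finRange_succ, List.map_cons, List.prod_cons, List.map_map, map_list_prod, List.map_map]
  congr 1
  congr 1
  apply List.map_congr_left
  intro k _
  exact (T_dp T i _ _).symm

/-- The set of PBW monomials. -/
def PB (w : List I) : Set (Uq D) := Set.range (pbw T w)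

theorem PB_cons (i : I) (l : List I) : PB T (i :: l) = DP (FF D i) * (T i '' PB T l) := by
  ext t
  constructor
  · rintro ⟨a, rfl⟩
    rw [pbw_cons]
    exact Set.mul_mem_mul ⟨_, rfl⟩ ⟨_, ⟨_, rfl⟩, rfl⟩
  · rintro ⟨_, ⟨n, rfl⟩, _, ⟨_, ⟨a, rfl⟩, rfl⟩, rfl⟩
    refine ⟨(Fin.cons n a : Fin (l.length + 1) → ℕ), ?_⟩
    rw [pbw_cons]
    rfl

theorem T_image_mul (i : I) (S U : Set (Uq D)) : T i '' (S * U) = (T i '' S) * (T i '' U) :=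
  Set.image_mul (T i)

theorem latt_cons (i : I) (u v : List I) (h : latt T u = latt T v) :
    latt T (i :: u) = latt T (i :: v) := by
  change Submodule.span _ (PB T _) = Submodule.span _ (PB T _)
  rw [PB_cons, PB_cons]
  exact span_mul_congr (fun _ _ => rfl) rfl (span_image_congr_gen (fun _ _ => rfl) (T i) h)

theorem DP_comm {x y : Uq D} (h : x * y = y * x) : DP x * DP y = DP y * DP x := by
  have hc : ∀ m n, dp x m * dp y n = dp y n * dp x m := fun m n => by
    have : Commute x y := h
    exact (((this.pow_pow m n).smul_left _).smul_right _)
  ext t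
  constructor
  · rintro ⟨_, ⟨m, rfl⟩, _, ⟨n, rfl⟩, rfl⟩
    exact ⟨_, ⟨n, rfl⟩, _, ⟨m, rfl⟩, (hc m n).symm⟩
  · rintro ⟨_, ⟨n, rfl⟩, _, ⟨m, rfl⟩, rfl⟩
    exact ⟨_, ⟨m, rfl⟩, _, ⟨n, rfl⟩, hc m n⟩

theorem DP_triple (x y z : Uq D) : DP x * DP y * DP z =
    {t | ∃ a b c, t = dq x a * dq y b * dq z c} := by
  ext t
  constructor
  · rintro ⟨_, ⟨_, ⟨a, rfl⟩, _, ⟨b, rfl⟩, rfl⟩, _, ⟨c, rfl⟩, rfl⟩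
    exact ⟨a, b, c, rfl⟩
  · rintro ⟨a, b, c, rfl⟩
    exact ⟨_, ⟨_, ⟨a, rfl⟩, _, ⟨b, rfl⟩, rfl⟩, _, ⟨c, rfl⟩, rfl⟩

variable {T}

theorem latt_far (hT : IsLusztigAuts D T) (a b : I) (r : List I) (hab : a ≠ b)
    (h : D.adj a b = false) : latt T (a :: b :: r) = latt T (b :: a :: r) := by
  change Submodule.span _ (PB T _) = Submodule.span _ (PB T _)
  simp only [PB_cons, T_image_mul, T_DP, Set.image_image]
  rw [tFf hT hab h, tFf hT hab.symm (far_symm D h), ← mul_assoc, ← mul_assoc,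
    DP_comm (rFF D a b hab h)]
  simp only [far_rel hT hab h]

theorem PB_three (hT : IsLusztigAuts D T) (a b : I) (r : List I) (h : D.adj a b = true) :
    PB T (a :: b :: a :: r) = (DP (FF D a) * DP (FF D b * FF D a - qq • (FF D a * FF D b)) *
      DP (FF D b)) * ((fun x => T a (T b (T a x))) '' PB T r) := by
  simp only [PB_cons, T_image_mul, T_DP, Set.image_image]
  rw [tFa hT h, ttF hT h]
  simp only [mul_assoc]

theorem latt_adj (hT : IsLusztigAuts D T) (a b : I) (r : List I)
    (h : D.adj a b = true) : latt T (a :: b :: a :: r) = latt T (b :: a :: b :: r) := by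
  change Submodule.span _ (PB T _) = Submodule.span _ (PB T _)
  rw [PB_three hT a b r h, PB_three hT b a r (adj_symm D h)]
  simp only [braid_rel hT h]
  refine span_mul_congr (fun _ _ => rfl) ?_ rfl
  rw [DP_triple, DP_triple]
  have := tower_gen (A := Uq D) (fun _ _ => rfl)
  exact rank2 (rserre D a b h) (rserre D b a (adj_symm D h))

end PartD

/-- The `ℤ[q]`-lattice `𝓛 = span_{ℤ[q]} B_i` is independent
of the reduced expression `i` of `w₀`. -/
theorem latt_independent_of_reduced_word
    {I : Type} [Fintype I] [DecidableEq I] (D : ADEData I)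
    (T : I → (Uq D ≃ₐ[𝕂] Uq D)) (hT : IsLusztigAuts D T)
    (w w' : List I) (hw : IsRedW0 D w) (hw' : IsRedW0 D w') :
    latt T w = latt T w' := by
  exact matsumoto D (fun u v => latt T u = latt T v)
    ⟨fun _ => rfl, fun h => h.symm, fun h h' => h.trans h'⟩
    (fun i u v h => latt_cons T i u v h)
    (fun i j u hij h => latt_far hT i j u hij h)
    (fun i j u h => latt_adj hT i j u h)
    _ w w' rfl hw.1 hw'.1 (w0_unique D w w' hw hw')
end
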